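/- Assume s > d. Then for ℙ-almost every ω ∈ Ω, the uniformly random self-similar set F(ω) has positive d-dimensional Lebesgue measure. -/

import Mathlib

open MeasureTheory Filter Topology
open scoped ENNReal

noncomputable section

abbrev E (d : ℕ) : Type := EuclideanSpace ℝ (Fin d)

abbrev Od (d : ℕ) : Type := Matrix.orthogonalGroup (Fin d) ℝ

instance (d : ℕ) : MeasurableSpace (Od d) := borel _
instance (d : ℕ) : BorelSpace (Od d) := ⟨rfl⟩

/-- The action of an orthogonal matrix on Euclidean space, as a linear map. -/
def act (d : ℕ) (Q : Od d) : E d →ₗ[ℝ] E d :=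
  Matrix.toEuclideanLin (Q : Matrix (Fin d) (Fin d) ℝ)

/-- The set `J` of finite nonempty words: a word of length `k+1` is a function
`Fin (k+1) → Fin m`. -/
abbrev JW (m : ℕ) : Type := Σ k : ℕ, (Fin (k + 1) → Fin m)

noncomputable instance (m : ℕ) : DecidableEq (JW m) := fun _ _ => Classical.dec _

/-- The label space `(σ₋,σ₊) × O(d)`. -/
abbrev Label (d : ℕ) (σm σp : ℝ) : Type := ↥(Set.Ioo σm σp) × Od d

/-- The space `Ω` of labelled trees. -/
abbrev Omega (d m : ℕ) (σm σp : ℝ) : Type := JW m → Label d σm σp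

variable {d m : ℕ} {σm σp : ℝ}

/-- The similarity map `T_i^ω = r_i^ω • Q_i^ω` attached to the node `w`. -/
def Tnode (ω : Omega d m σm σp) (w : JW m) : E d →ₗ[ℝ] E d :=
  ((ω w).1 : ℝ) • act d (ω w).2

/-- The initial word `𝐢_{k+1}` (first `k+1` symbols) of an infinite word `i`. -/
def pre (i : ℕ → Fin m) (k : ℕ) : JW m := ⟨k, fun j => i j.1⟩

/-- `cumT ω i n = T_{𝐢_1} ∘ ⋯ ∘ T_{𝐢_n}`. -/
def cumT (ω : Omega d m σm σp) (i : ℕ → Fin m) : ℕ → (E d →ₗ[ℝ] E d)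
  | 0 => LinearMap.id
  | n + 1 => (cumT ω i n).comp (Tnode ω (pre i n))

/-- `cumR ω i n = 𝐫_{𝐢_n}^ω = r_{𝐢_1}^ω ⋯ r_{𝐢_n}^ω` (equal to 1 if `n = 0`). -/
def cumR (ω : Omega d m σm σp) (i : ℕ → Fin m) (n : ℕ) : ℝ :=
  ∏ k ∈ Finset.range n, ((ω (pre i k)).1 : ℝ)

/-- `𝐫_w^ω` for a finite word `w`. -/
def wordR (ω : Omega d m σm σp) {k : ℕ} (w : Fin k → Fin m) : ℝ :=
  ∏ j : Fin k, ((ω ⟨j.1, fun t => w (Fin.castLE j.2 t)⟩).1 : ℝ)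

/-- The `k`-th partial sum `a_{i_1} + T_{𝐢_1}(a_{i_2}) + ⋯ + T_{𝐢_1}∘⋯∘T_{𝐢_k}(a_{i_{k+1}})`. -/
def partialSum (a : Fin m → E d) (ω : Omega d m σm σp) (i : ℕ → Fin m) (k : ℕ) : E d :=
  ∑ n ∈ Finset.range (k + 1), cumT ω i n (a (i n))

/-- The point `π(i, ω)`. -/
def piMap (a : Fin m → E d) (ω : Omega d m σm σp) (i : ℕ → Fin m) : E d :=
  ∑' n : ℕ, cumT ω i n (a (i n))

/-- `cumTFrom ω i p q = T_{𝐢_{p+2}} ∘ ⋯ ∘ T_{𝐢_{p+1+q}}`. -/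
def cumTFrom (ω : Omega d m σm σp) (i : ℕ → Fin m) (p : ℕ) : ℕ → (E d →ₗ[ℝ] E d)
  | 0 => LinearMap.id
  | q + 1 => (cumTFrom ω i p q).comp (Tnode ω (pre i (p + 1 + q)))

/-- The random vector `x(i, ω, p)`. -/
def xMap (a : Fin m → E d) (ω : Omega d m σm σp) (i : ℕ → Fin m) (p : ℕ) : E d :=
  ∑' q : ℕ, cumTFrom ω i p q (a (i (p + 1 + q)))

/-- The uniform probability measure on `(σ₋, σ₊)`, as a measure on `ℝ`. -/
def unif (σm σp : ℝ) : Measure ℝ :=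
  (ENNReal.ofReal (σp - σm))⁻¹ • (volume.restrict (Set.Ioo σm σp))

/-- The uniform probability measure on `(σ₋, σ₊)`, as a measure on the subtype. -/
def unifSub (σm σp : ℝ) : Measure ↥(Set.Ioo σm σp) :=
  (ENNReal.ofReal (σp - σm))⁻¹ • ((volume : Measure ℝ).comap Subtype.val)

/-- The measure `λ × θ` on the label space. -/
def labelM (σm σp : ℝ) {d : ℕ} (θ : Measure (Od d)) : Measure (Label d σm σp) :=
  (unifSub σm σp).prod θ

/-- The cylinder `[w]` of a finite word `w`. -/
def cyl {m k : ℕ} (w : Fin k → Fin m) : Set (ℕ → Fin m) := {j | ∀ t : Fin k, j t.1 = w t}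

/-- The cylinder `[w]` of a node `w : JW m`. -/
def cylNode {m : ℕ} (w : JW m) : Set (ℕ → Fin m) := {j | ∀ t : Fin (w.1 + 1), j t.1 = w.2 t}

/-- The σ-algebra `𝓕_k` generated by the labels at nodes of length at most `k`. -/
def Fk (d m : ℕ) (σm σp : ℝ) (k : ℕ) : MeasurableSpace (Omega d m σm σp) :=
  ⨆ w : {w : JW m // w.1 + 1 ≤ k}, MeasurableSpace.comap (fun ω => ω w.1) inferInstance

/-- `P` is the product measure `(λ×θ)^J`: coordinates are independent with law `λ×θ`. -/
def IsProductLaw (θ : Measure (Od d)) (P : Measure (Omega d m σm σp)) : Prop :=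
  ∀ (S : Finset (JW m)) (A : JW m → Set (Label d σm σp)),
    (∀ w, MeasurableSet (A w)) →
    P {ω | ∀ w ∈ S, ω w ∈ A w} = ∏ w ∈ S, labelM σm σp θ (A w)

/-- The uniformly random self-similar set `F(ω)`. -/
def Fset (a : Fin m → E d) (ω : Omega d m σm σp) : Set (E d) := Set.range (piMap a ω)

/-- `w` is an initial subword of `v`. -/
def isPrefix {m : ℕ} (w v : JW m) : Prop :=
  ∃ h : w.1 ≤ v.1, ∀ t : Fin (w.1 + 1), v.2 (Fin.castLE (Nat.succ_le_succ h) t) = w.2 t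

end


noncomputable section SecA

variable {d m : ℕ} {σm σp : ℝ}

lemma act_mul (Q R : Od d) (x : E d) : act d (Q * R) x = act d Q (act d R x) := by
  simp [act, Matrix.toEuclideanLin, Matrix.toLpLin_mul_same]

lemma act_one (x : E d) : act d 1 x = x := by
  simp [act, Matrix.toEuclideanLin]

lemma norm_act (Q : Od d) (x : E d) : ‖act d Q x‖ = ‖x‖ := by
  have h : ‖act d Q x‖ ^ 2 = ‖x‖ ^ 2 := by
    rw [EuclideanSpace.real_norm_sq_eq, EuclideanSpace.real_norm_sq_eq]
    have h1 : ∀ y : E d, ∑ i, y i ^ 2 = (WithLp.ofLp y) ⬝ᵥ (WithLp.ofLp y) := by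
      intro y; simp [dotProduct, sq]
    rw [h1, h1]
    simp only [act, Matrix.toEuclideanLin, Matrix.toLpLin_apply]
    rw [Matrix.dotProduct_mulVec, Matrix.vecMul_mulVec, ← Matrix.dotProduct_mulVec,
      ← Matrix.mulVec_mulVec]
    have h2 : (Q : Matrix (Fin d) (Fin d) ℝ).transpose * (Q : Matrix (Fin d) (Fin d) ℝ) = 1 :=
      (Matrix.mem_orthogonalGroup_iff' _ _).1 Q.2
    rw [Matrix.mulVec_mulVec, h2, Matrix.one_mulVec]
  exact (sq_eq_sq₀ (norm_nonneg _) (norm_nonneg _)).1 h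

lemma exists_act (x y : E d) (h : ‖x‖ = ‖y‖) : ∃ Q : Od d, act d Q x = y := by
  let R : E d ≃ₗᵢ[ℝ] E d := Submodule.reflection (ℝ ∙ (x - y))ᗮ
  have hR : R x = y := Submodule.reflection_sub h
  let b := EuclideanSpace.basisFun (Fin d) ℝ
  refine ⟨⟨_, R.toMatrix_mem_unitaryGroup b b⟩, ?_⟩
  rw [← hR]
  simp only [act]
  rw [Matrix.toEuclideanLin_eq_toLin_orthonormal]
  simp [b, Matrix.toLin_toMatrix]

lemma continuous_act : Continuous (fun p : Od d × E d => act d p.1 p.2) := by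
  simp only [act, Matrix.toEuclideanLin, Matrix.toLpLin_apply]
  refine (PiLp.continuous_toLp 2 _).comp ?_
  refine Continuous.matrix_mulVec (continuous_subtype_val.comp continuous_fst) ?_
  exact (PiLp.continuous_ofLp 2 _).comp continuous_snd

instance instSCMat : SecondCountableTopology (Matrix (Fin d) (Fin d) ℝ) :=
  inferInstanceAs (SecondCountableTopology (Fin d → Fin d → ℝ))

instance instSCOd : SecondCountableTopology (Od d) :=
  Topology.IsEmbedding.subtypeVal.secondCountableTopology

lemma measurable_act : Measurable (fun p : Od d × E d => act d p.1 p.2) :=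
  continuous_act.measurable

/-- the similarity of a label -/
def Tl (l : Label d σm σp) : E d →ₗ[ℝ] E d := (l.1 : ℝ) • act d l.2

lemma measurable_Tl : Measurable (fun p : Label d σm σp × E d => Tl p.1 p.2) := by
  have h1 : Measurable (fun p : Label d σm σp × E d => (p.1.2, p.2)) :=
    (measurable_snd.comp measurable_fst).prodMk measurable_snd
  have h2 : Measurable (fun p : Label d σm σp × E d => (p.1.1 : ℝ)) :=
    measurable_subtype_coe.comp (measurable_fst.comp measurable_fst)
  have h3 : Measurable (fun p : Label d σm σp × E d => act d p.1.2 p.2) := by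
    have h4 := measurable_act.comp h1
    exact h4
  exact h2.smul h3

lemma norm_Tl (hσ0 : 0 < σm) (l : Label d σm σp) (x : E d) : ‖Tl l x‖ = l.1 * ‖x‖ := by
  have : 0 < (l.1 : ℝ) := hσ0.trans l.1.2.1
  simp [Tl, norm_smul, norm_act, abs_of_pos this]

/-- subtree -/
def sub (ω : Omega d m σm σp) (i : Fin m) : Omega d m σm σp :=
  fun w => ω ⟨w.1 + 1, Fin.cons (α := fun _ => Fin m) i w.2⟩

/-- first level label -/
def rt (ω : Omega d m σm σp) (i : Fin m) : Label d σm σp := ω ⟨0, fun _ => i⟩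

lemma measurable_sub (i : Fin m) : Measurable (fun ω : Omega d m σm σp => sub ω i) :=
  measurable_pi_lambda _ fun _ => measurable_pi_apply _

lemma measurable_rt (i : Fin m) : Measurable (fun ω : Omega d m σm σp => rt ω i) :=
  measurable_pi_apply _

lemma pre_zero (i : ℕ → Fin m) : pre i 0 = ⟨0, fun _ => i 0⟩ := by
  simp only [pre]
  congr 1
  funext j
  have h : j.1 = 0 := by omega
  rw [h]

lemma pre_succ (i : ℕ → Fin m) (k : ℕ) :
    pre i (k + 1) = ⟨(pre (fun n => i (n + 1)) k).1 + 1,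
      Fin.cons (α := fun _ => Fin m) (i 0) (pre (fun n => i (n + 1)) k).2⟩ := by
  simp only [pre]
  congr 1
  funext j
  refine Fin.cases ?_ (fun j => ?_) j
  · simp
  · simp

lemma Tnode_zero (ω : Omega d m σm σp) (i : ℕ → Fin m) :
    Tnode ω (pre i 0) = Tl (rt ω (i 0)) := by
  rw [pre_zero]; rfl

lemma Tnode_succ (ω : Omega d m σm σp) (i : ℕ → Fin m) (k : ℕ) :
    Tnode ω (pre i (k + 1)) = Tnode (sub ω (i 0)) (pre (fun n => i (n + 1)) k) := by
  rw [pre_succ]; rfl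

lemma cumT_succ' (ω : Omega d m σm σp) (i : ℕ → Fin m) (n : ℕ) :
    cumT ω i (n + 1) = (Tl (rt ω (i 0))).comp (cumT (sub ω (i 0)) (fun n => i (n + 1)) n) := by
  induction n with
  | zero => simp [cumT, Tnode_zero]
  | succ n ih =>
    rw [cumT, ih, cumT, Tnode_succ, LinearMap.comp_assoc]

lemma norm_cumT_le (hσ0 : 0 < σm) (ω : Omega d m σm σp) (i : ℕ → Fin m) (n : ℕ) (x : E d) :
    ‖cumT ω i n x‖ ≤ σp ^ n * ‖x‖ := by
  induction n generalizing ω i with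
  | zero => simp [cumT]
  | succ n ih =>
    rw [cumT_succ', LinearMap.comp_apply, norm_Tl hσ0, pow_succ', mul_assoc]
    have h := (rt ω (i 0)).1.2
    exact mul_le_mul h.2.le (ih _ _) (norm_nonneg _) (by linarith [h.1, h.2])

lemma norm_term_le (hσ0 : 0 < σm) (a : Fin m → E d) (ω : Omega d m σm σp) (i : ℕ → Fin m)
    (n : ℕ) : ‖cumT ω i n (a (i n))‖ ≤ σp ^ n * ∑ j, ‖a j‖ := by
  have hp : 0 < σp := by
    have h := (rt ω (i 0)).1.2
    linarith [h.1, h.2]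
  refine (norm_cumT_le hσ0 ω i n _).trans ?_
  gcongr
  exact Finset.single_le_sum (f := fun j => ‖a j‖) (fun _ _ => norm_nonneg _) (Finset.mem_univ _)

lemma summable_bd (hσ0 : 0 < σm) (hσ1 : σm ≤ σp) (hσ2 : σp < 1) (a : Fin m → E d) :
    Summable (fun n : ℕ => σp ^ n * ∑ j, ‖a j‖) :=
  (summable_geometric_of_lt_one (hσ0.le.trans hσ1) hσ2).mul_right _

lemma summable_term (hσ0 : 0 < σm) (hσ1 : σm ≤ σp) (hσ2 : σp < 1) (a : Fin m → E d)
    (ω : Omega d m σm σp) (i : ℕ → Fin m) :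
    Summable (fun n => cumT ω i n (a (i n))) :=
  Summable.of_norm_bounded (summable_bd hσ0 hσ1 hσ2 a) (norm_term_le hσ0 a ω i)

lemma piMap_succ (hσ0 : 0 < σm) (hσ1 : σm ≤ σp) (hσ2 : σp < 1) (a : Fin m → E d)
    (ω : Omega d m σm σp) (i : ℕ → Fin m) :
    piMap a ω i = a (i 0) + Tl (rt ω (i 0)) (piMap a (sub ω (i 0)) (fun n => i (n + 1))) := by
  unfold piMap
  rw [(summable_term hσ0 hσ1 hσ2 a ω i).tsum_eq_zero_add]
  congr 1
  simp only [cumT_succ', LinearMap.comp_apply]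
  exact ((Tl (rt ω (i 0))).toContinuousLinearMap.map_tsum
    (summable_term hσ0 hσ1 hσ2 a (sub ω (i 0)) (fun n => i (n + 1)))).symm

/-- a bound for the size of `F` -/
def RB (σp : ℝ) (a : Fin m → E d) : ℝ := ∑' n : ℕ, σp ^ n * ∑ j, ‖a j‖

lemma norm_piMap_le (hσ0 : 0 < σm) (hσ1 : σm ≤ σp) (hσ2 : σp < 1) (a : Fin m → E d)
    (ω : Omega d m σm σp) (i : ℕ → Fin m) : ‖piMap a ω i‖ ≤ RB σp a :=
  tsum_of_norm_bounded (summable_bd hσ0 hσ1 hσ2 a).hasSum (norm_term_le hσ0 a ω i)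

lemma cumT_congr (ω : Omega d m σm σp) (i j : ℕ → Fin m) (n : ℕ) (h : ∀ k < n, i k = j k) :
    cumT ω i n = cumT ω j n := by
  induction n with
  | zero => rfl
  | succ n ih =>
    rw [cumT, cumT, ih (fun k hk => h k (by omega))]
    congr 2
    simp only [pre]
    congr 1
    funext t
    exact h t.1 t.2

lemma continuous_piMap (hσ0 : 0 < σm) (hσ1 : σm ≤ σp) (hσ2 : σp < 1) (a : Fin m → E d)
    (ω : Omega d m σm σp) : Continuous (piMap a ω) := by
  refine continuous_tsum (fun n => ?_) (summable_bd hσ0 hσ1 hσ2 a)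
    (fun n i => norm_term_le hσ0 a ω i n)
  by_cases hne : Nonempty (Fin m)
  · obtain ⟨z⟩ := hne
    let g : (Fin (n + 1) → Fin m) → E d := fun w =>
      cumT ω (fun k => if h : k < n + 1 then w ⟨k, h⟩ else z) n (a (w (Fin.last n)))
    have : (fun i : ℕ → Fin m => cumT ω i n (a (i n))) =
        g ∘ (fun i (k : Fin (n + 1)) => i k.1) := by
      funext i
      simp only [g, Function.comp]
      rw [cumT_congr ω i (fun k => if h : k < n + 1 then i k else z)]
      · simp
      · intro k hk
        simp [show k < n + 1 by omega]
    rw [this]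
    refine continuous_of_discreteTopology.comp ?_
    fun_prop
  · have : IsEmpty (ℕ → Fin m) := ⟨fun f => hne ⟨f 0⟩⟩
    exact continuous_of_const (fun x => isEmptyElim x)

lemma isCompact_Fset (hσ0 : 0 < σm) (hσ1 : σm ≤ σp) (hσ2 : σp < 1) (a : Fin m → E d)
    (ω : Omega d m σm σp) : IsCompact (Fset a ω) :=
  isCompact_range (continuous_piMap hσ0 hσ1 hσ2 a ω)

lemma Fset_sub (hσ0 : 0 < σm) (hσ1 : σm ≤ σp) (hσ2 : σp < 1) (a : Fin m → E d)
    (ω : Omega d m σm σp) (i : Fin m) {x : E d} (hx : x ∈ Fset a (sub ω i)) :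
    a i + Tl (rt ω i) x ∈ Fset a ω := by
  obtain ⟨j, rfl⟩ := hx
  refine ⟨fun n => Nat.casesOn n i j, ?_⟩
  exact piMap_succ hσ0 hσ1 hσ2 _ _ _

lemma det_Tl_ne (hσ0 : 0 < σm) (l : Label d σm σp) : LinearMap.det (Tl l) ≠ 0 := by
  have h0 : 0 < (l.1 : ℝ) := hσ0.trans l.1.2.1
  have hinj : Function.Injective (Tl l) := by
    rw [injective_iff_map_eq_zero]
    intro x hx
    have := norm_Tl hσ0 l x
    rw [hx, norm_zero] at this
    have := (mul_eq_zero.1 this.symm).resolve_left h0.ne'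
    exact norm_eq_zero.1 this
  have hu : IsUnit (Tl l) := (LinearMap.isUnit_iff_ker_eq_bot _).2 (LinearMap.ker_eq_bot.2 hinj)
  exact (LinearMap.isUnit_iff_isUnit_det _).1 hu |>.ne_zero

lemma vol_sub_pos (hσ0 : 0 < σm) (hσ1 : σm ≤ σp) (hσ2 : σp < 1) (a : Fin m → E d)
    (ω : Omega d m σm σp) (i : Fin m) (h : 0 < (volume : Measure (E d)) (Fset a (sub ω i))) :
    0 < (volume : Measure (E d)) (Fset a ω) := by
  have h1 : (fun x => a i + x) '' (Tl (rt ω i) '' Fset a (sub ω i)) ⊆ Fset a ω := by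
    rintro _ ⟨_, ⟨x, hx, rfl⟩, rfl⟩
    exact Fset_sub hσ0 hσ1 hσ2 a ω i hx
  refine lt_of_lt_of_le ?_ (measure_mono h1)
  rw [Set.image_add_left, measure_preimage_add, Measure.addHaar_image_linearMap]
  refine ENNReal.mul_pos ?_ h.ne'
  simpa using det_Tl_ne hσ0 _

lemma measurable_cumT (i : ℕ → Fin m) (n : ℕ) (x : E d) :
    Measurable (fun ω : Omega d m σm σp => cumT ω i n x) := by
  induction n generalizing i with
  | zero => simp [cumT]
  | succ n ih =>
    simp only [cumT_succ', LinearMap.comp_apply]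
    exact measurable_Tl.comp ((measurable_rt _).prodMk ((ih _).comp (measurable_sub _)))

lemma measurable_piMap (hσ0 : 0 < σm) (hσ1 : σm ≤ σp) (hσ2 : σp < 1) (a : Fin m → E d)
    (i : ℕ → Fin m) : Measurable (fun ω : Omega d m σm σp => piMap a ω i) := by
  refine measurable_of_tendsto_metrizable
    (f := fun n (ω : Omega d m σm σp) => ∑ k ∈ Finset.range n, cumT ω i k (a (i k))) ?_ ?_
  · intro n
    exact Finset.measurable_sum _ (fun k _ => measurable_cumT _ _ _)
  · rw [tendsto_pi_nhds]
    intro ω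
    exact (summable_term hσ0 hσ1 hσ2 a ω i).hasSum.tendsto_sum_nat

end SecA


noncomputable section SecB

variable {d m : ℕ} {σm σp : ℝ}

lemma lintegral_unifSub (f : ℝ → ℝ≥0∞) :
    ∫⁻ r, f (r : ℝ) ∂(unifSub σm σp) =
      (ENNReal.ofReal (σp - σm))⁻¹ * ∫⁻ r in Set.Ioo σm σp, f r := by
  rw [unifSub, lintegral_smul_measure, smul_eq_mul, lintegral_subtype_comap measurableSet_Ioo]

lemma unifSub_prob (h : σm < σp) : IsProbabilityMeasure (unifSub σm σp) := by
  constructor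
  have := lintegral_unifSub (σm := σm) (σp := σp) (fun _ => 1)
  rw [lintegral_one] at this
  rw [this]
  simp only [lintegral_const, one_mul, Measure.restrict_apply MeasurableSet.univ, Set.univ_inter,
    Real.volume_Ioo]
  exact ENNReal.inv_mul_cancel (by simpa using h) ENNReal.ofReal_ne_top

lemma labelM_prob (h : σm < σp) (θ : Measure (Od d)) [IsProbabilityMeasure θ] :
    IsProbabilityMeasure (labelM σm σp θ) := by
  have := unifSub_prob h
  unfold labelM; infer_instance

lemma law_eq (θ : Measure (Od d)) [IsProbabilityMeasure (labelM σm σp θ)]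
    {P P' : Measure (Omega d m σm σp)} (h : IsProductLaw θ P) (h' : IsProductLaw θ P') :
    P = P' := by
  have key : ∀ Q : Measure (Omega d m σm σp), IsProductLaw θ Q →
      Q = Measure.infinitePi (fun _ : JW m => labelM σm σp θ) := by
    intro Q hQ
    refine Measure.eq_infinitePi _ ?_
    intro S A hA
    have := hQ S A hA
    rw [← this]
    congr 1
  rw [key P h, key P' h']

/-- glue two configurations -/
def glue (S : Set (JW m)) (p : Omega d m σm σp × Omega d m σm σp) : Omega d m σm σp :=
  open Classical in fun w => if w ∈ S then p.1 w else p.2 w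

lemma measurable_glue (S : Set (JW m)) :
    Measurable (glue S : Omega d m σm σp × Omega d m σm σp → Omega d m σm σp) := by
  refine measurable_pi_lambda _ fun w => ?_
  by_cases h : w ∈ S
  · simp only [glue, h, if_true]
    exact (measurable_pi_apply w).comp measurable_fst
  · simp only [glue, h, if_false]
    exact (measurable_pi_apply w).comp measurable_snd

lemma glue_law (θ : Measure (Od d)) [IsProbabilityMeasure (labelM σm σp θ)]
    (P : Measure (Omega d m σm σp)) [IsProbabilityMeasure P] (h : IsProductLaw θ P)
    (S : Set (JW m)) : (P.prod P).map (glue S) = P := by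
  refine law_eq θ ?_ h
  classical
  intro U A hA
  have hms : ∀ V : Finset (JW m), MeasurableSet {ω : Omega d m σm σp | ∀ w ∈ V, ω w ∈ A w} := by
    intro V
    have := MeasurableSet.pi (s := (V : Set (JW m))) V.countable_toSet (fun w _ => hA w)
    exact this
  rw [Measure.map_apply (measurable_glue S) (hms U)]
  have : glue S ⁻¹' {ω : Omega d m σm σp | ∀ w ∈ U, ω w ∈ A w} =
      {ω | ∀ w ∈ U.filter (· ∈ S), ω w ∈ A w} ×ˢ {ω | ∀ w ∈ U.filter (· ∉ S), ω w ∈ A w} := by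
    ext ⟨ω, ω'⟩
    simp only [glue, Set.mem_preimage, Set.mem_ofPred_eq, Set.mem_prod, Finset.mem_filter]
    constructor
    · intro H
      refine ⟨fun w hw => ?_, fun w hw => ?_⟩
      · simpa [hw.2] using H w hw.1
      · simpa [hw.2] using H w hw.1
    · rintro ⟨H1, H2⟩ w hw
      by_cases hS : w ∈ S
      · simpa [hS] using H1 w ⟨hw, hS⟩
      · simpa [hS] using H2 w ⟨hw, hS⟩
  rw [this, Measure.prod_prod, h _ _ hA, h _ _ hA, Finset.prod_filter_mul_prod_filter_not]

lemma split_lintegral (θ : Measure (Od d)) [IsProbabilityMeasure (labelM σm σp θ)]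
    (P : Measure (Omega d m σm σp)) [IsProbabilityMeasure P] (h : IsProductLaw θ P)
    (S : Set (JW m)) (Φ : Omega d m σm σp × Omega d m σm σp → ℝ≥0∞) (hΦ : Measurable Φ)
    (h1 : ∀ ω₁ ω₂ ω₁' ω₂', (∀ w ∈ S, ω₁ w = ω₂ w) → (∀ w ∉ S, ω₁' w = ω₂' w) →
      Φ (ω₁, ω₁') = Φ (ω₂, ω₂')) :
    ∫⁻ ω, Φ (ω, ω) ∂P = ∫⁻ ω, ∫⁻ ω', Φ (ω, ω') ∂P ∂P := by
  have hd : Measurable (fun ω : Omega d m σm σp => (ω, ω)) := measurable_id.prodMk measurable_id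
  have hd2 : Measurable (fun ω : Omega d m σm σp => Φ (ω, ω)) := hΦ.comp hd
  rw [← lintegral_prod _ hΦ.aemeasurable]
  conv_lhs => rw [← glue_law θ P h S]
  rw [lintegral_map hd2 (measurable_glue S)]
  refine lintegral_congr fun p => ?_
  refine h1 _ _ _ _ ?_ ?_
  · intro w hw; simp [glue, hw]
  · intro w hw; simp [glue, hw]

lemma rt_law (θ : Measure (Od d)) (P : Measure (Omega d m σm σp)) (h : IsProductLaw θ P)
    (i : Fin m) : P.map (fun ω => rt ω i) = labelM σm σp θ := by
  ext A hA
  rw [Measure.map_apply (measurable_rt i) hA]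
  have := h {⟨0, fun _ => i⟩} (fun _ => A) (fun _ => hA)
  simp only [Finset.mem_singleton, forall_eq, Finset.prod_singleton] at this
  rw [← this]
  rfl

lemma sub_law (θ : Measure (Od d)) [IsProbabilityMeasure (labelM σm σp θ)]
    (P : Measure (Omega d m σm σp)) (h : IsProductLaw θ P)
    (i : Fin m) : P.map (fun ω => sub ω i) = P := by
  refine law_eq θ ?_ h
  classical
  intro U A hA
  have hms : MeasurableSet {ω : Omega d m σm σp | ∀ w ∈ U, ω w ∈ A w} := by
    have := MeasurableSet.pi (s := (U : Set (JW m))) U.countable_toSet (fun w _ => hA w)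
    exact this
  rw [Measure.map_apply (measurable_sub i) hms]
  let c : JW m → JW m := fun w => ⟨w.1 + 1, Fin.cons (α := fun _ => Fin m) i w.2⟩
  let t : JW m → JW m := fun w => match w with
    | ⟨0, v⟩ => ⟨0, v⟩
    | ⟨k + 1, v⟩ => ⟨k, fun j => v j.succ⟩
  have htc : ∀ w, t (c w) = w := by
    rintro ⟨k, v⟩
    simp [t, c]
  have hc : Function.Injective c := Function.LeftInverse.injective htc
  have := h (U.image c) (fun w => A (t w)) (fun w => hA _)
  rw [Finset.prod_image (fun x _ y _ hxy => hc hxy)] at this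
  simp only [htc, Finset.forall_mem_image] at this
  exact this

lemma E1 (θ : Measure (Od d)) [IsProbabilityMeasure (labelM σm σp θ)]
    (P : Measure (Omega d m σm σp)) [IsProbabilityMeasure P] (h : IsProductLaw θ P)
    (i : Fin m) (Φ : Label d σm σp × Omega d m σm σp → ℝ≥0∞) (hΦ : Measurable Φ) :
    ∫⁻ ω, Φ (rt ω i, sub ω i) ∂P = ∫⁻ l, ∫⁻ ω, Φ (l, ω) ∂P ∂(labelM σm σp θ) := by
  have hm : Measurable (fun p : Omega d m σm σp × Omega d m σm σp => (rt p.1 i, sub p.2 i)) :=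
    ((measurable_rt i).comp measurable_fst).prodMk ((measurable_sub i).comp measurable_snd)
  have := split_lintegral θ P h {⟨0, fun _ => i⟩} (fun p => Φ (rt p.1 i, sub p.2 i))
    (hΦ.comp hm) (by
      intro ω₁ ω₂ ω₁' ω₂' H1 H2
      have e1 : rt ω₁ i = rt ω₂ i := H1 _ rfl
      have e2 : sub ω₁' i = sub ω₂' i := by
        funext w
        refine H2 _ ?_
        intro hw
        have := congrArg Sigma.fst (Set.mem_singleton_iff.1 hw)
        simp at this
      simp only [e1, e2])
  simp only at this
  rw [this]
  have hin : Measurable (fun l : Label d σm σp => ∫⁻ ω, Φ (l, ω) ∂P) :=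
    hΦ.lintegral_prod_right'
  rw [← rt_law θ P h i, lintegral_map hin (measurable_rt i)]
  refine lintegral_congr fun ω => ?_
  have hin2 : Measurable (fun ω' : Omega d m σm σp => Φ (rt ω i, ω')) :=
    hΦ.comp measurable_prodMk_left
  conv_rhs => rw [← sub_law θ P h i]
  rw [lintegral_map hin2 (measurable_sub i)]

lemma E1' (θ : Measure (Od d)) [IsProbabilityMeasure (labelM σm σp θ)]
    (P : Measure (Omega d m σm σp)) [IsProbabilityMeasure P] (h : IsProductLaw θ P)
    (i : Fin m) (Φ : Label d σm σp × Omega d m σm σp → ℝ≥0∞) (hΦ : Measurable Φ) :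
    ∫⁻ ω, Φ (rt ω i, sub ω i) ∂P = ∫⁻ ω, ∫⁻ l, Φ (l, ω) ∂(labelM σm σp θ) ∂P := by
  rw [E1 θ P h i Φ hΦ]
  exact lintegral_lintegral_swap hΦ.aemeasurable

lemma E2 (θ : Measure (Od d)) [IsProbabilityMeasure (labelM σm σp θ)]
    (P : Measure (Omega d m σm σp)) [IsProbabilityMeasure P] (h : IsProductLaw θ P)
    (i j : Fin m) (hij : i ≠ j)
    (Φ : (Label d σm σp × Omega d m σm σp) × (Label d σm σp × Omega d m σm σp) → ℝ≥0∞)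
    (hΦ : Measurable Φ) :
    ∫⁻ ω, Φ ((rt ω i, sub ω i), (rt ω j, sub ω j)) ∂P =
      ∫⁻ ω, ∫⁻ ω', ∫⁻ l, ∫⁻ l', Φ ((l, ω), (l', ω')) ∂(labelM σm σp θ) ∂(labelM σm σp θ)
        ∂P ∂P := by
  have hm : Measurable (fun p : Omega d m σm σp × Omega d m σm σp =>
      ((rt p.1 i, sub p.1 i), (rt p.2 j, sub p.2 j))) :=
    (((measurable_rt i).comp measurable_fst).prodMk
      ((measurable_sub i).comp measurable_fst)).prodMk
    (((measurable_rt j).comp measurable_snd).prodMk ((measurable_sub j).comp measurable_snd))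
  have := split_lintegral θ P h {w | w.2 0 = i}
    (fun p => Φ ((rt p.1 i, sub p.1 i), (rt p.2 j, sub p.2 j)))
    (hΦ.comp hm) (by
      intro ω₁ ω₂ ω₁' ω₂' H1 H2
      have e1 : rt ω₁ i = rt ω₂ i := H1 _ rfl
      have e2 : sub ω₁ i = sub ω₂ i := by
        funext w
        exact H1 _ rfl
      have e3 : rt ω₁' j = rt ω₂' j := H2 _ (fun hh => hij hh.symm)
      have e4 : sub ω₁' j = sub ω₂' j := by
        funext w
        exact H2 _ (fun hh => hij hh.symm)
      simp only [e1, e2, e3, e4])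
  simp only at this
  rw [this]
  have a1 : ∀ p : Label d σm σp × Omega d m σm σp,
      ∫⁻ ω', Φ (p, (rt ω' j, sub ω' j)) ∂P
        = ∫⁻ ω', ∫⁻ l', Φ (p, (l', ω')) ∂(labelM σm σp θ) ∂P := by
    intro p
    exact E1' θ P h j (fun q => Φ (p, q)) (hΦ.comp measurable_prodMk_left)
  simp only [a1]
  have m0 : Measurable (fun t : ((Label d σm σp × Omega d m σm σp) × Omega d m σm σp) ×
      Label d σm σp => Φ (t.1.1, (t.2, t.1.2))) := by
    have m00 : Measurable (fun t : ((Label d σm σp × Omega d m σm σp) × Omega d m σm σp) ×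
      Label d σm σp => (t.1.1, (t.2, t.1.2))) :=
      (measurable_fst.comp measurable_fst).prodMk
        (measurable_snd.prodMk (measurable_snd.comp measurable_fst))
    exact hΦ.comp m00
  have m1 : Measurable (fun t : (Label d σm σp × Omega d m σm σp) × Omega d m σm σp =>
      ∫⁻ l', Φ (t.1, (l', t.2)) ∂(labelM σm σp θ)) := m0.lintegral_prod_right'
  have m2 : Measurable (fun t : (Label d σm σp × Omega d m σm σp) =>
      ∫⁻ ω', ∫⁻ l', Φ (t, (l', ω')) ∂(labelM σm σp θ) ∂P) := m1.lintegral_prod_right'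
  rw [E1' θ P h i (fun p => ∫⁻ ω', ∫⁻ l', Φ (p, (l', ω')) ∂(labelM σm σp θ) ∂P) m2]
  refine lintegral_congr fun ω => ?_
  refine lintegral_lintegral_swap (f := fun l ω' =>
    ∫⁻ l', Φ ((l, ω), (l', ω')) ∂(labelM σm σp θ)) ?_
  have m3 : Measurable (fun q : Label d σm σp × Omega d m σm σp => ((q.1, ω), q.2)) :=
    (measurable_fst.prodMk measurable_const).prodMk measurable_snd
  have m4 := m1.comp m3
  exact m4.aemeasurable

end SecB


noncomputable section SecC

variable {d m : ℕ} {σm σp : ℝ}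

lemma measurable_Tl_left (x : E d) : Measurable (fun l : Label d σm σp => Tl l x) := by
  have h : Measurable (fun l : Label d σm σp => (l, x)) := measurable_id.prodMk measurable_const
  have := measurable_Tl.comp h
  exact this

lemma dens_inv (θ : Measure (Od d)) [IsProbabilityMeasure θ] [θ.IsMulLeftInvariant]
    [SFinite (unifSub σm σp)] (R : Od d) (x y : E d) (ρ : ℝ) :
    labelM σm σp θ {l | ‖act d R y + Tl l x‖ ≤ ρ} = labelM σm σp θ {l | ‖y + Tl l x‖ ≤ ρ} := by
  have hmp : MeasurePreserving (Prod.map id (fun Q : Od d => R * Q))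
      (labelM σm σp θ) (labelM σm σp θ) := by
    unfold labelM
    exact (MeasurePreserving.id _).prod (measurePreserving_mul_left θ R)
  have hms : MeasurableSet {l : Label d σm σp | ‖act d R y + Tl l x‖ ≤ ρ} :=
    measurableSet_le (measurable_const.add (measurable_Tl_left x)).norm measurable_const
  rw [← hmp.measure_preimage hms.nullMeasurableSet]
  congr 1
  ext l
  have : act d R y + Tl (Prod.map id (fun Q : Od d => R * Q) l) x = act d R (y + Tl l x) := by
    simp [Tl, act_mul]
  simp only [Set.mem_preimage, Set.mem_ofPred_eq]
  rw [this, norm_act]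

lemma dens_rad (h : σm < σp) (θ : Measure (Od d)) [IsProbabilityMeasure θ]
    (b t ρ : ℝ) (hb : 0 < b) :
    labelM σm σp θ {l | |(l.1 : ℝ) * b - t| ≤ ρ} ≤ ENNReal.ofReal (2 * ρ / (b * (σp - σm))) := by
  have := unifSub_prob h
  have h1 : {l : Label d σm σp | |(l.1 : ℝ) * b - t| ≤ ρ} =
      {r : Set.Ioo σm σp | |(r : ℝ) * b - t| ≤ ρ} ×ˢ Set.univ := by
    ext l; simp
  rw [labelM, h1, Measure.prod_prod, measure_univ, mul_one, unifSub, Measure.smul_apply,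
    smul_eq_mul]
  have h2 : (volume : Measure ℝ).comap Subtype.val {r : Set.Ioo σm σp | |(r : ℝ) * b - t| ≤ ρ} ≤
      ENNReal.ofReal (2 * ρ / b) := by
    rw [(MeasurableEmbedding.subtype_coe measurableSet_Ioo).comap_apply]
    refine (measure_mono (t := Set.Icc ((t - ρ) / b) ((t + ρ) / b)) ?_).trans ?_
    · rintro _ ⟨r, hr, rfl⟩
      have hr' := abs_le.1 (show |(r : ℝ) * b - t| ≤ ρ from hr)
      constructor
      · rw [div_le_iff₀ hb]; linarith
      · rw [le_div_iff₀ hb]; linarith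
    · rw [Real.volume_Icc]
      apply ENNReal.ofReal_le_ofReal
      rw [← sub_div]; apply le_of_eq; ring
  calc _ ≤ (ENNReal.ofReal (σp - σm))⁻¹ * ENNReal.ofReal (2 * ρ / b) := by gcongr
    _ = _ := by
      rw [← ENNReal.ofReal_inv_of_pos (by linarith), ← ENNReal.ofReal_mul (by
        apply inv_nonneg.2; linarith)]
      congr 1
      have : σp - σm ≠ 0 := by linarith
      field_simp

lemma vol_shell (hd : 1 ≤ d) (t t0 ρ : ℝ) (ht0 : 0 < t0) (ht : t0 ≤ t) (hρ : 0 < ρ) :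
    ENNReal.ofReal (t0 ^ (d - 1) * ρ) * (volume : Measure (E d)) (Metric.ball 0 1) ≤
      (volume : Measure (E d)) (Metric.closedBall 0 (t + ρ) \ Metric.ball 0 t) := by
  have htp : 0 < t := ht0.trans_le ht
  have hne : Nonempty (Fin d) := ⟨⟨0, hd⟩⟩
  refine le_trans ?_ (le_measure_sdiff)
  rw [Measure.addHaar_closedBall _ _ (by linarith), Measure.addHaar_ball _ _ htp.le,
    finrank_euclideanSpace_fin, ← ENNReal.sub_mul (fun _ _ => measure_ball_lt_top.ne),
    ← ENNReal.ofReal_sub _ (by positivity)]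
  gcongr
  obtain ⟨k, rfl⟩ : ∃ k, d = k + 1 := ⟨d - 1, by omega⟩
  simp only [Nat.add_sub_cancel]
  have h1 : t0 ^ k ≤ t ^ k := by gcongr
  have h2 : t ^ k ≤ (t + ρ) ^ k := by gcongr; linarith
  have : t0 ^ k * ρ ≤ t ^ k * ρ := by gcongr
  rw [pow_succ, pow_succ]
  have h3 : t ^ k * (t + ρ) ≤ (t + ρ) ^ k * (t + ρ) := by gcongr
  nlinarith

lemma dens (hd : 1 ≤ d) (hσ0 : 0 < σm) (h : σm < σp) (θ : Measure (Od d))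
    [IsProbabilityMeasure θ] [θ.IsMulLeftInvariant] (c : ℝ) (hc : 0 < c) :
    ∃ C : ℝ, 0 ≤ C ∧ ∀ x : E d, c ≤ ‖x‖ → ∀ (y : E d) (ρ : ℝ), 0 < ρ →
      labelM σm σp θ {l | ‖y + Tl l x‖ ≤ ρ} ≤ ENNReal.ofReal (C * ρ ^ d) := by
  have := unifSub_prob h
  have := labelM_prob h θ
  set t0 : ℝ := σm * c / 2 with ht0
  have ht0p : 0 < t0 := by positivity
  have hσ : 0 < σp - σm := by linarith
  set C1 : ℝ := (1 / t0) ^ d with hC1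
  set C2 : ℝ := 2 ^ d * (6 / (c * (σp - σm))) / t0 ^ (d - 1) with hC2
  have hC1p : 0 ≤ C1 := by positivity
  have hC2p : 0 ≤ C2 := by positivity
  refine ⟨C1 + C2, by positivity, ?_⟩
  intro x hx y ρ hρ
  have hxp : 0 < ‖x‖ := hc.trans_le hx
  have hlow : ∀ l : Label d σm σp, 2 * t0 ≤ ‖Tl l x‖ := by
    intro l
    rw [norm_Tl hσ0]
    have := l.1.2.1
    calc 2 * t0 = σm * c := by rw [ht0]; ring
      _ ≤ l.1 * ‖x‖ := mul_le_mul this.le hx hc.le (by linarith)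
  rcases le_or_gt t0 ρ with hρ0 | hρ0
  · refine prob_le_one.trans ?_
    rw [← ENNReal.ofReal_one]
    apply ENNReal.ofReal_le_ofReal
    have : 1 ≤ C1 * ρ ^ d := by
      rw [hC1, ← mul_pow]
      apply one_le_pow₀
      rw [one_div, inv_mul_eq_div, le_div_iff₀ ht0p]; linarith
    nlinarith [show 0 ≤ C2 * ρ ^ d by positivity]
  rcases lt_or_ge ‖y‖ t0 with hy | hy
  · have : {l : Label d σm σp | ‖y + Tl l x‖ ≤ ρ} = ∅ := by
      ext l
      simp only [Set.mem_ofPred_eq, Set.mem_empty_iff_false, iff_false, not_le]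
      have h1 := norm_sub_norm_le (Tl l x) (-y)
      rw [norm_neg, sub_neg_eq_add, add_comm] at h1
      linarith [hlow l]
    rw [this]; simp
  set t := ‖y‖ with ht
  set A : Set (E d) := Metric.closedBall 0 (t + ρ) \ Metric.ball 0 t with hA
  have hAm : MeasurableSet A := Metric.isClosed_closedBall.measurableSet.diff
    Metric.isOpen_ball.measurableSet
  have htp : 0 < t := ht0p.trans_le hy
  set V := (volume : Measure (E d)) (Metric.ball 0 1) with hV
  have hV0 : V ≠ 0 := (Metric.measure_ball_pos _ _ one_pos).ne'
  have hVt : V ≠ ⊤ := measure_ball_lt_top.ne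
  set N := labelM σm σp θ {l | ‖y + Tl l x‖ ≤ ρ} with hN
  set D : Set (E d × Label d σm σp) := {p | ‖p.1 + Tl p.2 x‖ ≤ 2 * ρ} with hD
  have hDm : MeasurableSet D := by
    have h1 : Measurable (fun p : E d × Label d σm σp => Tl p.2 x) :=
      (measurable_Tl_left x).comp measurable_snd
    exact measurableSet_le (measurable_fst.add h1).norm measurable_const
  have step1 : (volume A) * N ≤ ((volume.restrict A).prod (labelM σm σp θ)) D := by
    rw [Measure.prod_apply hDm]
    calc (volume A) * N = ∫⁻ z in A, N := by rw [lintegral_const]; simp [mul_comm]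
      _ ≤ _ := by
        refine setLIntegral_mono' hAm fun z hz => ?_
        have hz1 : ‖z‖ ≤ t + ρ := by simpa using hz.1
        have hz2 : t ≤ ‖z‖ := by simpa using hz.2
        have hzp : 0 < ‖z‖ := htp.trans_le hz2
        have hn : ‖y‖ = ‖(t / ‖z‖) • z‖ := by
          rw [norm_smul, Real.norm_of_nonneg (by positivity)]
          field_simp; exact ht.symm
        obtain ⟨R, hR⟩ := exists_act y _ hn
        rw [hN, ← dens_inv θ R, hR]
        refine measure_mono ?_
        intro l hl
        have hl' : ‖(t / ‖z‖) • z + Tl l x‖ ≤ ρ := hl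
        show ‖z + Tl l x‖ ≤ 2 * ρ
        have hd1 : ‖z - (t / ‖z‖) • z‖ ≤ ρ := by
          have : z - (t / ‖z‖) • z = (1 - t / ‖z‖) • z := by rw [sub_smul, one_smul]
          rw [this, norm_smul, Real.norm_of_nonneg]
          · rw [sub_mul, one_mul, div_mul_cancel₀ _ hzp.ne']; linarith
          · rw [sub_nonneg, div_le_one hzp]; exact hz2
        calc ‖z + Tl l x‖ = ‖(z - (t / ‖z‖) • z) + ((t / ‖z‖) • z + Tl l x)‖ := by
              congr 1; abel
          _ ≤ _ := norm_add_le _ _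
          _ ≤ 2 * ρ := by linarith
  have step2 : ((volume.restrict A).prod (labelM σm σp θ)) D ≤
      ENNReal.ofReal ((2 * ρ) ^ d) * V * ENNReal.ofReal (2 * (3 * ρ) / (‖x‖ * (σp - σm))) := by
    rw [Measure.prod_apply_symm hDm]
    set B : Set (Label d σm σp) := {l | |(l.1 : ℝ) * ‖x‖ - t| ≤ 3 * ρ} with hB
    have hBm : MeasurableSet B := by
      have h1 : Measurable (fun l : Label d σm σp => (l.1 : ℝ) * ‖x‖ - t) :=
        ((measurable_subtype_coe.comp measurable_fst).mul_const _).sub_const _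
      exact measurableSet_le h1.abs measurable_const
    calc _ ≤ ∫⁻ l, B.indicator (fun _ => ENNReal.ofReal ((2 * ρ) ^ d) * V) l
            ∂(labelM σm σp θ) := by
          refine lintegral_mono fun l => ?_
          by_cases hl : l ∈ B
          · rw [Set.indicator_of_mem hl]
            refine (Measure.restrict_apply_le _ _).trans ?_
            have : (fun z => (z, l)) ⁻¹' D = Metric.closedBall (-(Tl l x)) (2 * ρ) := by
              ext z
              simp [hD, dist_eq_norm]
            rw [this, Measure.addHaar_closedBall _ _ (by positivity), finrank_euclideanSpace_fin]
          · rw [Set.indicator_of_notMem hl]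
            rw [Measure.restrict_apply (measurable_prodMk_right hDm)]
            have : (fun z => (z, l)) ⁻¹' D ∩ A = ∅ := by
              ext z
              simp only [Set.mem_inter_iff, Set.mem_empty_iff_false, iff_false, not_and]
              intro hz1 hz2
              apply hl
              have hz3 : ‖z + Tl l x‖ ≤ 2 * ρ := hz1
              have hz4 : ‖z‖ ≤ t + ρ := by simpa using hz2.1
              have hz5 : t ≤ ‖z‖ := by simpa using hz2.2
              show |(l.1 : ℝ) * ‖x‖ - t| ≤ 3 * ρ
              rw [← norm_Tl hσ0]
              have e1 := norm_sub_norm_le (Tl l x) (-z)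
              have e2 := norm_sub_norm_le (-z) (Tl l x)
              have e3 : ‖-z - Tl l x‖ = ‖z + Tl l x‖ := by
                rw [← norm_neg]; congr 1; abel
              rw [norm_neg, sub_neg_eq_add, add_comm (Tl l x)] at e1
              rw [e3, norm_neg] at e2
              rw [abs_le]; constructor <;> linarith
            rw [this]; simp
      _ = ENNReal.ofReal ((2 * ρ) ^ d) * V * labelM σm σp θ B := by
          rw [lintegral_indicator_const hBm]
      _ ≤ _ := by
          gcongr
          exact dens_rad h θ ‖x‖ t (3 * ρ) hxp
  have step3 := vol_shell hd t t0 ρ ht0p hy hρ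
  have step4 : V * (ENNReal.ofReal (t0 ^ (d - 1) * ρ) * N) ≤
      V * (ENNReal.ofReal (t0 ^ (d - 1) * ρ) * ENNReal.ofReal (C2 * ρ ^ d)) := by
    calc V * (ENNReal.ofReal (t0 ^ (d - 1) * ρ) * N)
        = ENNReal.ofReal (t0 ^ (d - 1) * ρ) * V * N := by ring
      _ ≤ volume A * N := by gcongr
      _ ≤ _ := step1
      _ ≤ _ := step2
      _ = V * (ENNReal.ofReal ((2 * ρ) ^ d * (2 * (3 * ρ) / (‖x‖ * (σp - σm))))) := by
          rw [ENNReal.ofReal_mul (by positivity)]; ring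
      _ ≤ V * (ENNReal.ofReal (t0 ^ (d - 1) * ρ * (C2 * ρ ^ d))) := by
          refine mul_le_mul' le_rfl (ENNReal.ofReal_le_ofReal ?_)
          calc (2 * ρ) ^ d * (2 * (3 * ρ) / (‖x‖ * (σp - σm)))
              ≤ (2 * ρ) ^ d * (2 * (3 * ρ) / (c * (σp - σm))) := by gcongr
            _ = t0 ^ (d - 1) * ρ * (C2 * ρ ^ d) := by
              rw [hC2, mul_pow]
              have : t0 ^ (d - 1) ≠ 0 := by positivity
              field_simp; ring
      _ = _ := by rw [ENNReal.ofReal_mul (by positivity)]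
  have step5 := (ENNReal.mul_le_mul_iff_right hV0 hVt).1 step4
  have step6 := (ENNReal.mul_le_mul_iff_right (by
    rw [Ne, ENNReal.ofReal_eq_zero, not_le]; positivity) ENNReal.ofReal_ne_top).1 step5
  refine step6.trans (ENNReal.ofReal_le_ofReal ?_)
  nlinarith [show 0 ≤ C1 * ρ ^ d by positivity]

/-- indicator of a closed ball around zero -/
def ind (ρ : ℝ) (v : E d) : ℝ≥0∞ := (Metric.closedBall (0 : E d) ρ).indicator (fun _ => 1) v

lemma measurable_ind (ρ : ℝ) : Measurable (ind ρ : E d → ℝ≥0∞) :=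
  measurable_const.indicator Metric.isClosed_closedBall.measurableSet

lemma ind_le_one (ρ : ℝ) (v : E d) : ind ρ v ≤ 1 :=
  Set.indicator_le_self' (by simp) _

lemma ind_of_le {ρ : ℝ} {v : E d} (h : ‖v‖ ≤ ρ) : ind ρ v = 1 :=
  Set.indicator_of_mem (by simpa using h) _

lemma ind_of_lt {ρ : ℝ} {v : E d} (h : ρ < ‖v‖) : ind ρ v = 0 :=
  Set.indicator_of_notMem (by simpa using h) _

lemma ind_congr {ρ ρ' : ℝ} {v v' : E d} (h : ‖v‖ ≤ ρ ↔ ‖v'‖ ≤ ρ') : ind ρ v = ind ρ' v' := by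
  by_cases hv : ‖v‖ ≤ ρ
  · rw [ind_of_le hv, ind_of_le (h.1 hv)]
  · rw [ind_of_lt (not_le.1 hv), ind_of_lt (not_le.1 (fun hh => hv (h.2 hh)))]

lemma lintegral_ind (θ : Measure (Od d)) (x y : E d) (ρ : ℝ) :
    ∫⁻ l, ind ρ (y + Tl l x) ∂(labelM σm σp θ) = labelM σm σp θ {l | ‖y + Tl l x‖ ≤ ρ} := by
  have hms : MeasurableSet {l : Label d σm σp | ‖y + Tl l x‖ ≤ ρ} :=
    measurableSet_le (measurable_const.add (measurable_Tl_left x)).norm measurable_const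
  rw [← lintegral_indicator_one hms]
  refine lintegral_congr fun l => ?_
  by_cases hl : ‖y + Tl l x‖ ≤ ρ
  · rw [ind_of_le hl, Set.indicator_of_mem (show l ∈ {l | ‖y + Tl l x‖ ≤ ρ} from hl)]; rfl
  · rw [ind_of_lt (not_le.1 hl),
      Set.indicator_of_notMem (show l ∉ {l | ‖y + Tl l x‖ ≤ ρ} from hl)]

lemma trans_pair (hd : 1 ≤ d) (hσ0 : 0 < σm) (h : σm < σp) (hσ2 : σp < 1) (θ : Measure (Od d))
    [IsProbabilityMeasure θ] [θ.IsMulLeftInvariant] (b0 : ℝ) (hb0 : 0 < b0) :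
    ∃ C : ℝ, 0 ≤ C ∧ ∀ b : E d, b0 ≤ ‖b‖ → ∀ (x y : E d) (ρ : ℝ), 0 < ρ →
      ∫⁻ l, ∫⁻ l', ind ρ (b + Tl l x - Tl l' y) ∂(labelM σm σp θ) ∂(labelM σm σp θ) ≤
        ENNReal.ofReal (C * ρ ^ d) := by
  have := labelM_prob h θ
  obtain ⟨C, hC, H⟩ := dens hd hσ0 h θ (b0 / 4) (by positivity)
  refine ⟨C + (2 / b0) ^ d, by positivity, ?_⟩
  intro b hb x y ρ hρ
  have hCle : ENNReal.ofReal (C * ρ ^ d) ≤ ENNReal.ofReal ((C + (2 / b0) ^ d) * ρ ^ d) := by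
    apply ENNReal.ofReal_le_ofReal
    gcongr
    linarith [show 0 ≤ (2 / b0) ^ d by positivity]
  have hm2 : Measurable (fun p : Label d σm σp × Label d σm σp =>
      ind ρ (b + Tl p.1 x - Tl p.2 y)) := by
    have h1 : Measurable (fun p : Label d σm σp × Label d σm σp => Tl p.1 x) :=
      (measurable_Tl_left x).comp measurable_fst
    have h2 : Measurable (fun p : Label d σm σp × Label d σm σp => Tl p.2 y) :=
      (measurable_Tl_left y).comp measurable_snd
    exact (measurable_ind ρ).comp ((measurable_const.add h1).sub h2)
  rcases le_or_gt (b0 / 4) ‖y‖ with hy | hy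
  · refine le_trans ?_ hCle
    calc _ ≤ ∫⁻ l : Label d σm σp, ENNReal.ofReal (C * ρ ^ d) ∂(labelM σm σp θ) := by
          refine lintegral_mono fun l => ?_
          have e : ∀ l' : Label d σm σp, ind ρ (b + Tl l x - Tl l' y) = ind ρ (-(b + Tl l x) + Tl l' y) := by
            intro l'
            apply ind_congr
            rw [← norm_neg (b + Tl l x - Tl l' y), neg_sub, sub_eq_neg_add]
          simp only [e]
          rw [lintegral_ind]
          exact H y hy _ ρ hρ
      _ = _ := by simp
  rcases le_or_gt (b0 / 4) ‖x‖ with hx | hx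
  · refine le_trans ?_ hCle
    rw [lintegral_lintegral_swap hm2.aemeasurable]
    calc _ ≤ ∫⁻ l' : Label d σm σp, ENNReal.ofReal (C * ρ ^ d) ∂(labelM σm σp θ) := by
          refine lintegral_mono fun l' => ?_
          have e : ∀ l : Label d σm σp, ind ρ (b + Tl l x - Tl l' y) = ind ρ ((b - Tl l' y) + Tl l x) := by
            intro l
            congr 1
            abel
          simp only [e]
          rw [lintegral_ind]
          exact H x hx _ ρ hρ
      _ = _ := by simp
  rcases le_or_gt (b0 / 2) ρ with hρ0 | hρ0
  · calc _ ≤ ∫⁻ l : Label d σm σp, ∫⁻ l' : Label d σm σp, 1 ∂(labelM σm σp θ)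
          ∂(labelM σm σp θ) := by
          gcongr; exact ind_le_one _ _
      _ = ENNReal.ofReal 1 := by simp
      _ ≤ _ := by
        apply ENNReal.ofReal_le_ofReal
        have : 1 ≤ (2 / b0) ^ d * ρ ^ d := by
          rw [← mul_pow]
          apply one_le_pow₀
          rw [div_mul_eq_mul_div, le_div_iff₀ hb0]; linarith
        nlinarith [show 0 ≤ C * ρ ^ d by positivity]
  · have : ∀ l l', ind ρ (b + Tl (σm := σm) (σp := σp) l x - Tl (σm := σm) (σp := σp) l' y)
        = 0 := by
      intro l l'
      apply ind_of_lt
      have hl : ‖Tl l x‖ ≤ b0 / 4 := by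
        rw [norm_Tl hσ0]
        have := l.1.2
        nlinarith [norm_nonneg x, this.1, this.2]
      have hl' : ‖Tl l' y‖ ≤ b0 / 4 := by
        rw [norm_Tl hσ0]
        have := l'.1.2
        nlinarith [norm_nonneg y, this.1, this.2]
      have e : b = (b + Tl l x - Tl l' y) - (Tl l x - Tl l' y) := by abel
      have e1 := norm_sub_le (b + Tl l x - Tl l' y) (Tl l x - Tl l' y)
      rw [← e] at e1
      have e2 := norm_sub_le (Tl l x) (Tl l' y)
      linarith
    simp [this]

end SecC


noncomputable section SecD

variable {d m : ℕ} {σm σp : ℝ}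

/-- label weight -/
def wl (s : ℝ) (l : Label d σm σp) : ℝ≥0∞ := ENNReal.ofReal ((l.1 : ℝ) ^ s)

lemma measurable_wl (s : ℝ) : Measurable (wl s : Label d σm σp → ℝ≥0∞) := by
  have h1 : Measurable (fun l : Label d σm σp => (l.1 : ℝ)) :=
    measurable_subtype_coe.comp measurable_fst
  exact (h1.pow_const s).ennreal_ofReal

lemma lt_of_hs (m : ℕ) (s : ℝ) (hσ1 : σm ≤ σp)
    (hs : ((m : ℝ) / (σp - σm)) * (∫ r in σm..σp, r ^ s) = 1) : σm < σp := by
  rcases hσ1.lt_or_eq with h | h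
  · exact h
  · subst h; simp at hs

lemma lintegral_wl (s : ℝ) (hσ0 : 0 < σm) (h : σm < σp)
    (hs : ((m : ℝ) / (σp - σm)) * (∫ r in σm..σp, r ^ s) = 1)
    (θ : Measure (Od d)) [IsProbabilityMeasure θ] :
    (m : ℝ≥0∞) * ∫⁻ l, wl s l ∂(labelM σm σp θ) = 1 := by
  have := unifSub_prob h
  have h1 : ∫⁻ l, wl s l ∂(labelM σm σp θ) = ∫⁻ r, ENNReal.ofReal ((r : ℝ) ^ s) ∂(unifSub σm σp) := by
    rw [labelM, lintegral_prod _ (measurable_wl s).aemeasurable]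
    simp [wl]
  have hint : IntervalIntegrable (fun r : ℝ => r ^ s) volume σm σp := by
    apply ContinuousOn.intervalIntegrable
    intro r hr
    rw [Set.uIcc_of_le h.le] at hr
    exact (Real.continuousAt_rpow_const r s (Or.inl (by linarith [hr.1]))).continuousWithinAt
  have h2 : ∫⁻ r in Set.Ioo σm σp, ENNReal.ofReal (r ^ s) =
      ENNReal.ofReal (∫ r in σm..σp, r ^ s) := by
    rw [intervalIntegral.integral_of_le h.le,
      integral_Ioc_eq_integral_Ioo, ofReal_integral_eq_lintegral_ofReal]
    · exact ((intervalIntegrable_iff_integrableOn_Ioo_of_le h.le).1 hint)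
    · refine (ae_restrict_iff' measurableSet_Ioo).2 (Eventually.of_forall fun r hr => ?_)
      exact Real.rpow_nonneg (by linarith [hr.1]) _
  rw [h1, lintegral_unifSub (fun r => ENNReal.ofReal (r ^ s)), h2,
    ← ENNReal.ofReal_inv_of_pos (by linarith), ← ENNReal.ofReal_mul (by
      apply inv_nonneg.2; linarith), ← ENNReal.ofReal_natCast, ← ENNReal.ofReal_mul (by positivity),
      ← mul_assoc, ← div_eq_mul_inv, hs, ENNReal.ofReal_one]

lemma wl_le_one (s : ℝ) (hs : 0 < s) (hσ0 : 0 < σm) (hσ2 : σp < 1) (l : Label d σm σp) :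
    wl s l ≤ 1 := by
  have := l.1.2
  rw [wl, ← ENNReal.ofReal_one]
  exact ENNReal.ofReal_le_ofReal (Real.rpow_le_one (by linarith [this.1]) (by linarith [this.2]) hs.le)

/-- word weight -/
def Wt (s : ℝ) : (n : ℕ) → (Fin n → Fin m) → Omega d m σm σp → ℝ≥0∞
  | 0, _, _ => 1
  | n + 1, w, ω => wl s (rt ω (w 0)) * Wt s n (Fin.tail w) (sub ω (w 0))

/-- word point -/
def pt (a : Fin m → E d) (z : Fin m) : (n : ℕ) → (Fin n → Fin m) → Omega d m σm σp → E d
  | 0, _, ω => piMap a ω (fun _ => z)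
  | n + 1, w, ω => a (w 0) + Tl (rt ω (w 0)) (pt a z n (Fin.tail w) (sub ω (w 0)))

lemma measurable_Wt (s : ℝ) (n : ℕ) (w : Fin n → Fin m) :
    Measurable (Wt s n w : Omega d m σm σp → ℝ≥0∞) := by
  induction n with
  | zero => exact measurable_const
  | succ n ih =>
    have h1 : Measurable (fun ω : Omega d m σm σp => wl s (rt ω (w 0))) :=
      (measurable_wl s).comp (measurable_rt _)
    have h2 : Measurable (fun ω : Omega d m σm σp => Wt s n (Fin.tail w) (sub ω (w 0))) :=
      (ih _).comp (measurable_sub _)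
    exact h1.mul h2

lemma measurable_pt (hσ0 : 0 < σm) (hσ1 : σm ≤ σp) (hσ2 : σp < 1) (a : Fin m → E d) (z : Fin m)
    (n : ℕ) (w : Fin n → Fin m) :
    Measurable (pt a z n w : Omega d m σm σp → E d) := by
  induction n with
  | zero => exact measurable_piMap hσ0 hσ1 hσ2 a _
  | succ n ih =>
    have h2 : Measurable (fun ω : Omega d m σm σp => pt a z n (Fin.tail w) (sub ω (w 0))) :=
      (ih _).comp (measurable_sub _)
    have h3 := measurable_Tl.comp ((measurable_rt (w 0)).prodMk h2)
    exact measurable_const.add h3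

lemma pt_mem (hσ0 : 0 < σm) (hσ1 : σm ≤ σp) (hσ2 : σp < 1) (a : Fin m → E d) (z : Fin m)
    (n : ℕ) (w : Fin n → Fin m) (ω : Omega d m σm σp) : pt a z n w ω ∈ Fset a ω := by
  induction n generalizing ω with
  | zero => exact ⟨_, rfl⟩
  | succ n ih => exact Fset_sub hσ0 hσ1 hσ2 a ω _ (ih _ _)

lemma Wt_cons (s : ℝ) (n : ℕ) (i : Fin m) (w : Fin n → Fin m) (ω : Omega d m σm σp) :
    Wt s (n + 1) (Fin.cons (α := fun _ => Fin m) i w) ω = wl s (rt ω i) * Wt s n w (sub ω i) := by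
  simp [Wt]

lemma pt_cons (a : Fin m → E d) (z : Fin m) (n : ℕ) (i : Fin m) (w : Fin n → Fin m)
    (ω : Omega d m σm σp) :
    pt a z (n + 1) (Fin.cons (α := fun _ => Fin m) i w) ω =
      a i + Tl (rt ω i) (pt a z n w (sub ω i)) := by
  simp [pt]

lemma sum_words (n : ℕ) (f : (Fin (n + 1) → Fin m) → ℝ≥0∞) :
    ∑ w, f w = ∑ i, ∑ w, f (Fin.cons (α := fun _ => Fin m) i w) := by
  rw [← Fintype.sum_prod_type' (fun i w => f (Fin.cons (α := fun _ => Fin m) i w))]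
  exact (Fintype.sum_equiv (Fin.consEquiv (fun _ => Fin m)) _ _ (fun _ => rfl)).symm

section main
variable (θ : Measure (Od d)) [IsProbabilityMeasure (labelM σm σp θ)]
    (P : Measure (Omega d m σm σp)) [IsProbabilityMeasure P]

lemma first_moment (h : IsProductLaw θ P) (s : ℝ) (hw : (m : ℝ≥0∞) * ∫⁻ l, wl s l ∂(labelM σm σp θ) = 1) (n : ℕ) :
    ∑ w, ∫⁻ ω, Wt s n w ω ∂P = 1 := by
  induction n with
  | zero => simp [Wt]
  | succ n ih =>
    rw [sum_words]
    have e : ∀ (i : Fin m) (w : Fin n → Fin m),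
        ∫⁻ ω, Wt s (n + 1) (Fin.cons (α := fun _ => Fin m) i w) ω ∂P =
        (∫⁻ l, wl s l ∂(labelM σm σp θ)) * ∫⁻ ω, Wt s n w ω ∂P := by
      intro i w
      simp only [Wt_cons]
      have hΦ : Measurable (fun p : Label d σm σp × Omega d m σm σp => wl s p.1 * Wt s n w p.2) :=
        ((measurable_wl s).comp measurable_fst).mul ((measurable_Wt s n w).comp measurable_snd)
      rw [E1 θ P h i (fun p => wl s p.1 * Wt s n w p.2) hΦ]
      simp only
      rw [← lintegral_mul_const _ (measurable_wl s)]
      refine lintegral_congr fun l => ?_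
      rw [lintegral_const_mul _ (measurable_Wt s n w)]
    simp only [e, ← Finset.mul_sum, ih]
    simp only [mul_one, Finset.sum_const, Finset.card_univ, Fintype.card_fin, nsmul_eq_mul]
    rw [mul_comm]; exact hw

/-- pair energy -/
def Sn (P : Measure (Omega d m σm σp)) (s : ℝ) (a : Fin m → E d) (z : Fin m) (n : ℕ) (ρ : ℝ) :
    ℝ≥0∞ :=
  ∑ w, ∑ v, ∫⁻ ω, Wt s n w ω * Wt s n v ω * ind ρ (pt a z n w ω - pt a z n v ω) ∂P

lemma off_diag (h : IsProductLaw θ P) (s : ℝ) (hs : 0 < s) (hσ0 : 0 < σm) (hσ1 : σm ≤ σp) (hσ2 : σp < 1)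
    (a : Fin m → E d) (z : Fin m) (n : ℕ)
    (ρ : ℝ) (B : ℝ≥0∞) (i j : Fin m) (hij : i ≠ j)
    (hB : ∀ x y : E d, ∫⁻ l, ∫⁻ l', ind ρ (a i - a j + Tl l x - Tl l' y) ∂(labelM σm σp θ)
      ∂(labelM σm σp θ) ≤ B) (w v : Fin n → Fin m) :
    ∫⁻ ω, Wt s (n + 1) (Fin.cons (α := fun _ => Fin m) i w) ω *
      Wt s (n + 1) (Fin.cons (α := fun _ => Fin m) j v) ω *
      ind ρ (pt a z (n + 1) (Fin.cons (α := fun _ => Fin m) i w) ω -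
        pt a z (n + 1) (Fin.cons (α := fun _ => Fin m) j v) ω) ∂P ≤
      (∫⁻ ω, Wt s n w ω ∂P) * (∫⁻ ω, Wt s n v ω ∂P) * B := by
  simp only [Wt_cons, pt_cons]
  let Φ : (Label d σm σp × Omega d m σm σp) × (Label d σm σp × Omega d m σm σp) → ℝ≥0∞ :=
    fun p => (Wt s n w p.1.2 * Wt s n v p.2.2) *
      ind ρ (a i - a j + Tl p.1.1 (pt a z n w p.1.2) - Tl p.2.1 (pt a z n v p.2.2))
  have mT : ∀ u : Fin n → Fin m, Measurable (fun p : Label d σm σp × Omega d m σm σp =>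
      Tl p.1 (pt a z n u p.2)) := by
    intro u
    have h2 : Measurable (fun p : Label d σm σp × Omega d m σm σp => pt a z n u p.2) :=
      (measurable_pt hσ0 hσ1 hσ2 a z n u).comp measurable_snd
    have h3 := measurable_Tl.comp (measurable_fst.prodMk h2)
    exact h3
  have mΦ : Measurable Φ := by
    have h1 : Measurable (fun p : (Label d σm σp × Omega d m σm σp) ×
        (Label d σm σp × Omega d m σm σp) => Wt s n w p.1.2) :=
      (measurable_Wt s n w).comp (measurable_snd.comp measurable_fst)
    have h2 : Measurable (fun p : (Label d σm σp × Omega d m σm σp) ×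
        (Label d σm σp × Omega d m σm σp) => Wt s n v p.2.2) :=
      (measurable_Wt s n v).comp (measurable_snd.comp measurable_snd)
    have h3 := (mT w).comp (measurable_fst : Measurable (Prod.fst : (Label d σm σp × Omega d m σm σp) ×
      (Label d σm σp × Omega d m σm σp) → _))
    have h4 := (mT v).comp (measurable_snd : Measurable (Prod.snd : (Label d σm σp × Omega d m σm σp) ×
      (Label d σm σp × Omega d m σm σp) → _))
    have h5 := (measurable_ind ρ).comp ((measurable_const (a := a i - a j)).add h3 |>.sub h4)
    exact (h1.mul h2).mul h5
  calc _ ≤ ∫⁻ ω, Φ ((rt ω i, sub ω i), (rt ω j, sub ω j)) ∂P := by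
        refine lintegral_mono fun ω => ?_
        have e : a i + Tl (rt ω i) (pt a z n w (sub ω i)) -
            (a j + Tl (rt ω j) (pt a z n v (sub ω j))) =
            a i - a j + Tl (rt ω i) (pt a z n w (sub ω i)) -
              Tl (rt ω j) (pt a z n v (sub ω j)) := by abel
        simp only [Φ]
        rw [e]
        refine mul_le_mul' (mul_le_mul' ?_ ?_) le_rfl
        · exact mul_le_of_le_one_left' (wl_le_one s hs hσ0 hσ2 _)
        · exact mul_le_of_le_one_left' (wl_le_one s hs hσ0 hσ2 _)
    _ = _ := E2 θ P h i j hij Φ mΦ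
    _ ≤ ∫⁻ ω, ∫⁻ ω', Wt s n w ω * (Wt s n v ω' * B) ∂P ∂P := by
        refine lintegral_mono fun ω => lintegral_mono fun ω' => ?_
        simp only [Φ]
        have hT : ∀ u : E d, Measurable (fun l : Label d σm σp => Tl l u) := measurable_Tl_left
        have m2 : Measurable (fun p : Label d σm σp × Label d σm σp =>
            ind ρ (a i - a j + Tl p.1 (pt a z n w ω) - Tl p.2 (pt a z n v ω'))) := by
          have h3 := (hT (pt a z n w ω)).comp (measurable_fst :
            Measurable (Prod.fst : Label d σm σp × Label d σm σp → _))
          have h4 := (hT (pt a z n v ω')).comp (measurable_snd :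
            Measurable (Prod.snd : Label d σm σp × Label d σm σp → _))
          have h5 := (measurable_ind ρ).comp ((measurable_const (a := a i - a j)).add h3 |>.sub h4)
          exact h5
        have e : ∀ l : Label d σm σp, ∫⁻ l' : Label d σm σp, Wt s n w ω * Wt s n v ω' *
            ind ρ (a i - a j + Tl l (pt a z n w ω) - Tl l' (pt a z n v ω')) ∂(labelM σm σp θ) =
            Wt s n w ω * Wt s n v ω' * ∫⁻ l' : Label d σm σp,
            ind ρ (a i - a j + Tl l (pt a z n w ω) - Tl l' (pt a z n v ω')) ∂(labelM σm σp θ) := by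
          intro l
          have := m2.comp (measurable_prodMk_left (x := l))
          exact lintegral_const_mul _ this
        simp only [e]
        rw [lintegral_const_mul _ m2.lintegral_prod_right', mul_assoc]
        gcongr
        exact hB _ _
    _ = _ := by
        have e : ∀ ω : Omega d m σm σp, ∫⁻ ω' : Omega d m σm σp,
            Wt s n w ω * (Wt s n v ω' * B) ∂P = Wt s n w ω * ((∫⁻ ω, Wt s n v ω ∂P) * B) := by
          intro ω
          rw [lintegral_const_mul _ ((measurable_Wt s n v).mul_const _),
            lintegral_mul_const _ (measurable_Wt s n v)]
        simp only [e]
        rw [lintegral_mul_const _ (measurable_Wt s n w), mul_assoc]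

lemma diag (h : IsProductLaw θ P) (s : ℝ) (hσ0 : 0 < σm) (hσ1 : σm ≤ σp) (hσ2 : σp < 1)
    (a : Fin m → E d) (z : Fin m) (n : ℕ) (ρ : ℝ) (i : Fin m) :
    ∑ w, ∑ v, ∫⁻ ω, Wt s (n + 1) (Fin.cons (α := fun _ => Fin m) i w) ω *
      Wt s (n + 1) (Fin.cons (α := fun _ => Fin m) i v) ω *
      ind ρ (pt a z (n + 1) (Fin.cons (α := fun _ => Fin m) i w) ω -
        pt a z (n + 1) (Fin.cons (α := fun _ => Fin m) i v) ω) ∂P =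
      ∫⁻ l, wl s l * wl s l * Sn P s a z n (ρ / l.1) ∂(labelM σm σp θ) := by
  have mpt : ∀ u : Fin n → Fin m, Measurable (fun p : Label d σm σp × Omega d m σm σp =>
      pt a z n u p.2) := fun u => (measurable_pt hσ0 hσ1 hσ2 a z n u).comp measurable_snd
  have mdl : ∀ w v : Fin n → Fin m, Measurable (fun p : Label d σm σp × Omega d m σm σp =>
      ind ρ (Tl p.1 (pt a z n w p.2 - pt a z n v p.2))) := by
    intro w v
    have h3 := measurable_Tl.comp (measurable_fst.prodMk ((mpt w).sub (mpt v)))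
    have h4 := (measurable_ind ρ).comp h3
    exact h4
  have hind : ∀ (l : Label d σm σp) (x : E d), ind ρ (Tl l x) = ind (ρ / l.1) x := by
    intro l x
    apply ind_congr
    rw [norm_Tl hσ0, le_div_iff₀ (hσ0.trans l.1.2.1), mul_comm]
  have mΦ : ∀ w v : Fin n → Fin m, Measurable (fun p : Label d σm σp × Omega d m σm σp =>
      wl s p.1 * wl s p.1 * (Wt s n w p.2 * Wt s n v p.2 *
        ind ρ (Tl p.1 (pt a z n w p.2 - pt a z n v p.2)))) := by
    intro w v
    exact (((measurable_wl s).comp measurable_fst).mul ((measurable_wl s).comp measurable_fst)).mul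
      ((((measurable_Wt s n w).comp measurable_snd).mul
      ((measurable_Wt s n v).comp measurable_snd)).mul (mdl w v))
  have e : ∀ w v : Fin n → Fin m,
      ∫⁻ ω, Wt s (n + 1) (Fin.cons (α := fun _ => Fin m) i w) ω *
      Wt s (n + 1) (Fin.cons (α := fun _ => Fin m) i v) ω *
      ind ρ (pt a z (n + 1) (Fin.cons (α := fun _ => Fin m) i w) ω -
        pt a z (n + 1) (Fin.cons (α := fun _ => Fin m) i v) ω) ∂P =
      ∫⁻ l, ∫⁻ ω, wl s l * wl s l * (Wt s n w ω * Wt s n v ω *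
        ind ρ (Tl l (pt a z n w ω - pt a z n v ω))) ∂P ∂(labelM σm σp θ) := by
    intro w v
    rw [← E1 θ P h i (fun p => wl s p.1 * wl s p.1 * (Wt s n w p.2 * Wt s n v p.2 *
        ind ρ (Tl p.1 (pt a z n w p.2 - pt a z n v p.2)))) (mΦ w v)]
    refine lintegral_congr fun ω => ?_
    simp only [Wt_cons, pt_cons, add_sub_add_left_eq_sub, map_sub]
    ring
  simp only [e]
  have mI : ∀ w v : Fin n → Fin m, Measurable (fun l : Label d σm σp =>
      ∫⁻ ω, wl s l * wl s l * (Wt s n w ω * Wt s n v ω *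
        ind ρ (Tl l (pt a z n w ω - pt a z n v ω))) ∂P) :=
    fun w v => (mΦ w v).lintegral_prod_right'
  have e2 : ∀ w : Fin n → Fin m, ∑ v, ∫⁻ l, ∫⁻ ω, wl s l * wl s l * (Wt s n w ω * Wt s n v ω *
        ind ρ (Tl l (pt a z n w ω - pt a z n v ω))) ∂P ∂(labelM σm σp θ) =
      ∫⁻ l, ∑ v, ∫⁻ ω, wl s l * wl s l * (Wt s n w ω * Wt s n v ω *
        ind ρ (Tl l (pt a z n w ω - pt a z n v ω))) ∂P ∂(labelM σm σp θ) := by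
    intro w
    rw [lintegral_finsetSum _ (fun v _ => mI w v)]
  simp only [e2]
  rw [← lintegral_finsetSum _ (fun w _ => Finset.measurable_sum _ (fun v _ => mI w v))]
  refine lintegral_congr fun l => ?_
  unfold Sn
  simp only [Finset.mul_sum]
  refine Finset.sum_congr rfl fun w _ => Finset.sum_congr rfl fun v _ => ?_
  simp only [hind]
  rw [lintegral_const_mul]
  have h1 := measurable_Wt (d := d) (σm := σm) (σp := σp) s n w
  have h2 := measurable_Wt (d := d) (σm := σm) (σp := σp) s n v
  have h3 := (measurable_ind (ρ / l.1)).comp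
    ((measurable_pt hσ0 hσ1 hσ2 a z n w).sub (measurable_pt hσ0 hσ1 hσ2 a z n v))
  exact (h1.mul h2).mul h3

lemma energy (h : IsProductLaw θ P) (hd : 1 ≤ d) (hm : 2 ≤ m) (s : ℝ) (hs : (d : ℝ) < s) (hσ0 : 0 < σm) (hσ1 : σm < σp)
    (hσ2 : σp < 1) [IsProbabilityMeasure θ] [θ.IsMulLeftInvariant]
    (hw : (m : ℝ≥0∞) * ∫⁻ l, wl s l ∂(labelM σm σp θ) = 1)
    (a : Fin m → E d) (ha : Function.Injective a) (z : Fin m) :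
    ∃ K κ : ℝ, 0 ≤ K ∧ 0 < κ ∧ κ < 1 ∧ ∀ n (ρ : ℝ), 0 < ρ →
      Sn P s a z n ρ ≤ ENNReal.ofReal (K * ρ ^ d + κ ^ n) := by
  have hs0 : 0 < s := by
    have : (0 : ℝ) ≤ d := by positivity
    linarith
  obtain ⟨b0, hb0, hb⟩ : ∃ b0 : ℝ, 0 < b0 ∧ ∀ i j, i ≠ j → b0 ≤ ‖a i - a j‖ := by
    classical
    let T : Finset (Fin m × Fin m) := Finset.univ.filter (fun p => p.1 ≠ p.2)
    have hT : T.Nonempty := ⟨(⟨0, by omega⟩, ⟨1, by omega⟩), by simp [T]⟩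
    obtain ⟨p, hp, hmin⟩ := T.exists_min_image (fun p => ‖a p.1 - a p.2‖) hT
    refine ⟨‖a p.1 - a p.2‖, ?_, fun i j hij => hmin (i, j) (by simp [T, hij])⟩
    rw [norm_pos_iff, sub_ne_zero]
    exact fun hh => (Finset.mem_filter.1 hp).2 (ha hh)
  obtain ⟨C, hC, H⟩ := trans_pair hd hσ0 hσ1 hσ2 θ b0 hb0
  have hσp : 0 < σp := hσ0.trans hσ1
  set κ : ℝ := σp ^ (s - d) with hκ
  have hκ0 : 0 < κ := Real.rpow_pos_of_pos hσp _
  have hκ1 : κ < 1 := Real.rpow_lt_one hσp.le hσ2 (by linarith)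
  have h1κ : 0 < 1 - κ := by linarith
  set K : ℝ := m * m * C / (1 - κ) with hK
  have hK0 : 0 ≤ K := by positivity
  refine ⟨K, κ, hK0, hκ0, hκ1, ?_⟩
  intro n
  induction n with
  | zero =>
    intro ρ hρ
    simp only [Sn, Wt, pt, sub_self, one_mul, pow_zero]
    rw [Fintype.sum_unique, Fintype.sum_unique]
    calc _ ≤ ∫⁻ ω : Omega d m σm σp, 1 ∂P := by gcongr; exact ind_le_one _ _
      _ = ENNReal.ofReal 1 := by simp
      _ ≤ _ := ENNReal.ofReal_le_ofReal (by nlinarith [show 0 ≤ K * ρ ^ d by positivity])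
  | succ n ih =>
    intro ρ hρ
    set B : ℝ≥0∞ := ENNReal.ofReal (C * ρ ^ d) with hB
    let tm : Fin m → (Fin n → Fin m) → Fin m → (Fin n → Fin m) → ℝ≥0∞ := fun i w j v =>
      ∫⁻ ω, Wt s (n + 1) (Fin.cons (α := fun _ => Fin m) i w) ω *
      Wt s (n + 1) (Fin.cons (α := fun _ => Fin m) j v) ω *
      ind ρ (pt a z (n + 1) (Fin.cons (α := fun _ => Fin m) i w) ω -
        pt a z (n + 1) (Fin.cons (α := fun _ => Fin m) j v) ω) ∂P
    have hS : Sn P s a z (n + 1) ρ = ∑ i, ∑ j, ∑ w, ∑ v, tm i w j v := by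
      unfold Sn
      rw [sum_words]
      refine Finset.sum_congr rfl fun i _ => ?_
      rw [Finset.sum_comm (s := (Finset.univ : Finset (Fin m)))]
      refine Finset.sum_congr rfl fun w _ => ?_
      rw [sum_words]
    have hoff : ∀ i j, i ≠ j → ∑ w, ∑ v, tm i w j v ≤ B := by
      intro i j hij
      calc _ ≤ ∑ w, ∑ v, (∫⁻ ω, Wt s n w ω ∂P) * (∫⁻ ω, Wt s n v ω ∂P) * B := by
            refine Finset.sum_le_sum fun w _ => Finset.sum_le_sum fun v _ => ?_
            exact off_diag θ P h s hs0 hσ0 hσ1.le hσ2 a z n ρ B i j hij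
              (fun x y => H _ (hb i j hij) x y ρ hρ) w v
        _ = B := by
            have := first_moment θ P h s hw n
            simp only [← Finset.sum_mul, ← Finset.mul_sum, this, one_mul, mul_one]
    set D : ℝ≥0∞ := ENNReal.ofReal (κ * (K * ρ ^ d + κ ^ n)) with hD
    have hdiag : ∀ i, ∑ w, ∑ v, tm i w i v ≤ (∫⁻ l, wl s l ∂(labelM σm σp θ)) * D := by
      intro i
      rw [diag θ P h s hσ0 hσ1.le hσ2 a z n ρ i, ← lintegral_mul_const _ (measurable_wl s)]
      refine lintegral_mono fun l => ?_
      have hl : σm < (l.1 : ℝ) ∧ (l.1 : ℝ) < σp := l.1.2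
      have hr0 : (0 : ℝ) < l.1 := hσ0.trans hl.1
      rw [mul_assoc]
      gcongr
      refine (mul_le_mul' le_rfl (ih (ρ / l.1) (by positivity))).trans ?_
      rw [wl, ← ENNReal.ofReal_mul (by positivity), hD]
      apply ENNReal.ofReal_le_ofReal
      generalize (l.1 : ℝ) = r at hr0 hl ⊢
      have hrs : r ^ s = r ^ (s - d) * r ^ d := by
        rw [← Real.rpow_natCast r d, ← Real.rpow_add hr0]; congr 1; ring
      have hrk : r ^ (s - d) ≤ κ := Real.rpow_le_rpow hr0.le hl.2.le (by linarith)
      have hrd : r ^ d ≤ 1 := pow_le_one₀ hr0.le (by linarith [hl.2])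
      have hq : 0 ≤ r ^ (s - (d:ℝ)) := Real.rpow_nonneg hr0.le _
      calc r ^ s * (K * (ρ / r) ^ d + κ ^ n)
          = r ^ (s - d) * (K * ρ ^ d + r ^ d * κ ^ n) := by
            rw [hrs, div_pow]; field_simp
        _ ≤ κ * (K * ρ ^ d + 1 * κ ^ n) := by gcongr
        _ = _ := by ring
    calc Sn P s a z (n + 1) ρ = ∑ i, ∑ j, ∑ w, ∑ v, tm i w j v := hS
      _ ≤ ∑ i : Fin m, ∑ j : Fin m, (B + if i = j then
            (∫⁻ l, wl s l ∂(labelM σm σp θ)) * D else 0) := by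
          refine Finset.sum_le_sum fun i _ => Finset.sum_le_sum fun j _ => ?_
          by_cases hij : i = j
          · subst hij
            simp only [if_true]
            exact (hdiag i).trans le_add_self
          · simp only [hij, if_false, add_zero]
            exact hoff i j hij
      _ = m * m * B + (m * ∫⁻ l, wl s l ∂(labelM σm σp θ)) * D := by
          simp only [Finset.sum_add_distrib, Finset.sum_const, Finset.card_univ, Fintype.card_fin,
            nsmul_eq_mul, Finset.sum_ite_eq, Finset.mem_univ, if_true]
          ring
      _ = m * m * B + D := by rw [hw, one_mul]
      _ = ENNReal.ofReal (m * m * (C * ρ ^ d) + κ * (K * ρ ^ d + κ ^ n)) := by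
          rw [ENNReal.ofReal_add (by positivity) (by positivity),
            ENNReal.ofReal_mul (p := (m : ℝ) * m) (by positivity),
            ENNReal.ofReal_mul (p := (m : ℝ)) (by positivity), ENNReal.ofReal_natCast]
      _ ≤ _ := by
          apply ENNReal.ofReal_le_ofReal
          have : m * m * C = K * (1 - κ) := by rw [hK]; field_simp
          rw [← mul_assoc, this, pow_succ]
          apply le_of_eq; ring

end main

end SecD


noncomputable section SecE

variable {d m : ℕ} {σm σp : ℝ}

/-- neighbourhood of the finite approximation -/
def Gs (a : Fin m → E d) (z : Fin m) (n : ℕ) (δ : ℝ) : Set (Omega d m σm σp × E d) :=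
  ⋃ w : Fin n → Fin m, {p | ‖pt a z n w p.1 - p.2‖ ≤ δ}

lemma measurable_ptx (hσ0 : 0 < σm) (hσ1 : σm ≤ σp) (hσ2 : σp < 1) (a : Fin m → E d) (z : Fin m)
    (n : ℕ) (w : Fin n → Fin m) :
    Measurable (fun p : Omega d m σm σp × E d => pt a z n w p.1 - p.2) := by
  have h1 := (measurable_pt hσ0 hσ1 hσ2 a z n w).comp
    (measurable_fst : Measurable (Prod.fst : Omega d m σm σp × E d → _))
  exact h1.sub measurable_snd

lemma measurableSet_Gs (hσ0 : 0 < σm) (hσ1 : σm ≤ σp) (hσ2 : σp < 1) (a : Fin m → E d)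
    (z : Fin m) (n : ℕ) (δ : ℝ) :
    MeasurableSet (Gs a z n δ : Set (Omega d m σm σp × E d)) :=
  MeasurableSet.iUnion fun w =>
    measurableSet_le (measurable_ptx hσ0 hσ1 hσ2 a z n w).norm measurable_const

lemma lintegral_ind_sub (δ : ℝ) (p : E d) :
    ∫⁻ x : E d, ind δ (p - x) = volume (Metric.closedBall (0 : E d) δ) := by
  rw [lintegral_sub_left_eq_self (fun x => ind δ x) p]
  unfold ind
  rw [lintegral_indicator_const Metric.isClosed_closedBall.measurableSet, one_mul]

lemma ind_ind (δ : ℝ) (p q x : E d) :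
    ind δ (p - x) * ind δ (q - x) ≤ ind (2 * δ) (p - q) * ind δ (p - x) := by
  by_cases h1 : ‖p - x‖ ≤ δ
  · by_cases h2 : ‖q - x‖ ≤ δ
    · have : ‖p - q‖ ≤ 2 * δ := by
        have e : p - q = (p - x) - (q - x) := by abel
        rw [e]
        exact (norm_sub_le _ _).trans (by linarith)
      rw [ind_of_le h1, ind_of_le h2, ind_of_le this]
    · rw [ind_of_lt (not_le.1 h2)]; simp
  · rw [ind_of_lt (not_le.1 h1)]; simp

lemma pz_aux (g i c : ℝ≥0∞) (hc : c ≠ 0) (hct : c ≠ ⊤) (hi : i = 1 ∨ g = 0) :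
    g ≤ c * i + c⁻¹ * (g * g) := by
  rcases hi with rfl | rfl
  · rcases le_total g c with h | h
    · exact (h.trans (by rw [mul_one])).trans le_self_add
    · refine le_trans ?_ le_add_self
      calc g = c⁻¹ * c * g := by rw [ENNReal.inv_mul_cancel hc hct, one_mul]
        _ ≤ c⁻¹ * g * g := by gcongr
        _ = _ := mul_assoc _ _ _
  · simp

section main
variable (θ : Measure (Od d)) [IsProbabilityMeasure (labelM σm σp θ)]
    (P : Measure (Omega d m σm σp)) [IsProbabilityMeasure P]

/-- density -/
def gd (s : ℝ) (a : Fin m → E d) (z : Fin m) (n : ℕ) (δ : ℝ) (p : Omega d m σm σp × E d) : ℝ≥0∞ :=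
  ∑ w, Wt s n w p.1 * ind δ (pt a z n w p.1 - p.2)

lemma measurable_gterm (hσ0 : 0 < σm) (hσ1 : σm ≤ σp) (hσ2 : σp < 1) (s : ℝ)
    (a : Fin m → E d) (z : Fin m) (n : ℕ) (δ : ℝ) (w : Fin n → Fin m) :
    Measurable (fun p : Omega d m σm σp × E d =>
      Wt s n w p.1 * ind δ (pt a z n w p.1 - p.2)) := by
  have h1 := (measurable_Wt s n w).comp
    (measurable_fst : Measurable (Prod.fst : Omega d m σm σp × E d → _))
  have h2 := (measurable_ind δ).comp (measurable_ptx hσ0 hσ1 hσ2 a z n w)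
  exact h1.mul h2

lemma int_gd (h : IsProductLaw θ P) (hσ0 : 0 < σm) (hσ1 : σm ≤ σp) (hσ2 : σp < 1) (s : ℝ)
    (hw : (m : ℝ≥0∞) * ∫⁻ l, wl s l ∂(labelM σm σp θ) = 1)
    (a : Fin m → E d) (z : Fin m) (n : ℕ) (δ : ℝ) :
    ∫⁻ p, gd s a z n δ p ∂(P.prod volume) = volume (Metric.closedBall (0 : E d) δ) := by
  unfold gd
  rw [lintegral_finsetSum _ (fun w _ => measurable_gterm hσ0 hσ1 hσ2 s a z n δ w)]
  have e : ∀ w : Fin n → Fin m, ∫⁻ p : Omega d m σm σp × E d,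
      Wt s n w p.1 * ind δ (pt a z n w p.1 - p.2) ∂(P.prod volume) =
      (∫⁻ ω, Wt s n w ω ∂P) * volume (Metric.closedBall (0 : E d) δ) := by
    intro w
    rw [lintegral_prod _ (measurable_gterm hσ0 hσ1 hσ2 s a z n δ w).aemeasurable,
      ← lintegral_mul_const _ (measurable_Wt s n w)]
    refine lintegral_congr fun ω => ?_
    simp only
    rw [lintegral_const_mul, lintegral_ind_sub]
    exact (measurable_ind δ).comp (measurable_const.sub measurable_id)
  simp only [e]
  rw [← Finset.sum_mul, first_moment θ P h s hw n, one_mul]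

lemma int_gd2 (hσ0 : 0 < σm) (hσ1 : σm ≤ σp) (hσ2 : σp < 1) (s : ℝ)
    (a : Fin m → E d) (z : Fin m) (n : ℕ) (δ : ℝ) :
    ∫⁻ p, gd s a z n δ p * gd s a z n δ p ∂(P.prod volume) ≤
      volume (Metric.closedBall (0 : E d) δ) * Sn P s a z n (2 * δ) := by
  have mW := fun w : Fin n → Fin m => (measurable_Wt s n w).comp
    (measurable_fst : Measurable (Prod.fst : Omega d m σm σp × E d → _))
  have mx := fun w : Fin n → Fin m => measurable_ptx (d := d) hσ0 hσ1 hσ2 a z n w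
  have mp := fun w : Fin n → Fin m => (measurable_pt hσ0 hσ1 hσ2 a z n w).comp
    (measurable_fst : Measurable (Prod.fst : Omega d m σm σp × E d → _))
  have mΨ : ∀ w v : Fin n → Fin m, Measurable (fun p : Omega d m σm σp × E d =>
      (Wt s n w p.1 * Wt s n v p.1 * ind (2 * δ) (pt a z n w p.1 - pt a z n v p.1)) *
        ind δ (pt a z n w p.1 - p.2)) := by
    intro w v
    have h1 := (measurable_ind (2 * δ)).comp ((mp w).sub (mp v))
    have h2 := (measurable_ind δ).comp (mx w)
    exact (((mW w).mul (mW v)).mul h1).mul h2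
  have m0 : ∀ w v : Fin n → Fin m, Measurable (fun ω : Omega d m σm σp =>
      (Wt s n w ω * Wt s n v ω * ind (2 * δ) (pt a z n w ω - pt a z n v ω))) := by
    intro w v
    have h1 := (measurable_ind (2 * δ)).comp
      ((measurable_pt hσ0 hσ1 hσ2 a z n w).sub (measurable_pt hσ0 hσ1 hσ2 a z n v))
    exact ((measurable_Wt s n w).mul (measurable_Wt s n v)).mul h1
  calc _ ≤ ∫⁻ p : Omega d m σm σp × E d, ∑ w, ∑ v,
        (Wt s n w p.1 * Wt s n v p.1 * ind (2 * δ) (pt a z n w p.1 - pt a z n v p.1)) *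
        ind δ (pt a z n w p.1 - p.2) ∂(P.prod volume) := by
        refine lintegral_mono fun p => ?_
        simp only [gd]
        rw [Finset.sum_mul_sum]
        refine Finset.sum_le_sum fun w _ => Finset.sum_le_sum fun v _ => ?_
        calc _ = Wt s n w p.1 * Wt s n v p.1 *
              (ind δ (pt a z n w p.1 - p.2) * ind δ (pt a z n v p.1 - p.2)) := by ring
          _ ≤ Wt s n w p.1 * Wt s n v p.1 * (ind (2 * δ) (pt a z n w p.1 - pt a z n v p.1) *
              ind δ (pt a z n w p.1 - p.2)) := mul_le_mul' le_rfl (ind_ind _ _ _ _)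
          _ = _ := by ring
    _ = ∑ w, ∑ v, ∫⁻ p : Omega d m σm σp × E d,
        (Wt s n w p.1 * Wt s n v p.1 * ind (2 * δ) (pt a z n w p.1 - pt a z n v p.1)) *
        ind δ (pt a z n w p.1 - p.2) ∂(P.prod volume) := by
        rw [lintegral_finsetSum _ (fun w _ => Finset.measurable_sum _ (fun v _ => mΨ w v))]
        refine Finset.sum_congr rfl fun w _ => ?_
        rw [lintegral_finsetSum _ (fun v _ => mΨ w v)]
    _ = _ := by
        unfold Sn
        simp only [Finset.mul_sum]
        refine Finset.sum_congr rfl fun w _ => Finset.sum_congr rfl fun v _ => ?_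
        rw [lintegral_prod _ (mΨ w v).aemeasurable, ← lintegral_const_mul _ (m0 w v)]
        refine lintegral_congr fun ω => ?_
        simp only
        rw [lintegral_const_mul, lintegral_ind_sub, mul_comm]
        exact (measurable_ind δ).comp (measurable_const.sub measurable_id)

lemma vol_lower (h : IsProductLaw θ P) (hd : 1 ≤ d) (hm : 2 ≤ m) (s : ℝ) (hs : (d : ℝ) < s)
    (hσ0 : 0 < σm) (hσ1 : σm < σp) (hσ2 : σp < 1) [IsProbabilityMeasure θ] [θ.IsMulLeftInvariant]
    (hw : (m : ℝ≥0∞) * ∫⁻ l, wl s l ∂(labelM σm σp θ) = 1)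
    (a : Fin m → E d) (ha : Function.Injective a) (z : Fin m) :
    ∃ η : ℝ≥0∞, η ≠ 0 ∧ ∀ δ : ℝ, 0 < δ → ∃ n, η ≤ (P.prod volume) (Gs a z n δ) := by
  obtain ⟨K, κ, hK, hκ0, hκ1, H⟩ := energy θ P h hd hm s hs hσ0 hσ1 hσ2 hw a ha z
  set A : ℝ := K * 2 ^ d + 1 with hA
  have hAp : 0 < A := by positivity
  set V := (volume : Measure (E d)) (Metric.ball 0 1) with hV
  have hV0 : V ≠ 0 := (Metric.measure_ball_pos _ _ one_pos).ne'
  have hVt : V ≠ ⊤ := measure_ball_lt_top.ne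
  refine ⟨V / 2 / ENNReal.ofReal (2 * A), ?_, ?_⟩
  · refine (ENNReal.div_pos ?_ ENNReal.ofReal_ne_top).ne'
    exact (ENNReal.div_pos hV0 (by simp)).ne'
  intro δ hδ
  have hδd : 0 < δ ^ d := by positivity
  obtain ⟨n, hn⟩ := exists_pow_lt_of_lt_one hδd hκ1
  refine ⟨n, ?_⟩
  set U : ℝ≥0∞ := volume (Metric.closedBall (0 : E d) δ) with hU
  have hUV : U = ENNReal.ofReal (δ ^ d) * V := by
    rw [hU, Measure.addHaar_closedBall _ _ hδ.le, finrank_euclideanSpace_fin]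
  have hS : Sn P s a z n (2 * δ) ≤ ENNReal.ofReal (A * δ ^ d) := by
    refine (H n (2 * δ) (by positivity)).trans (ENNReal.ofReal_le_ofReal ?_)
    rw [mul_pow, hA]; nlinarith
  set c : ℝ≥0∞ := ENNReal.ofReal (2 * (A * δ ^ d)) with hc
  have hc0 : c ≠ 0 := by
    rw [hc, Ne, ENNReal.ofReal_eq_zero, not_le]; positivity
  have hct : c ≠ ⊤ := ENNReal.ofReal_ne_top
  have hGm := measurableSet_Gs hσ0 hσ1.le hσ2 a z n δ
  set G : Set (Omega d m σm σp × E d) := Gs a z n δ with hG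
  have mg : Measurable (gd s a z n δ : Omega d m σm σp × E d → ℝ≥0∞) :=
    Finset.measurable_sum _ (fun w _ => measurable_gterm hσ0 hσ1.le hσ2 s a z n δ w)
  have key : U ≤ c * (P.prod volume) G + U / 2 := by
    calc U = ∫⁻ p, gd s a z n δ p ∂(P.prod volume) :=
          (int_gd θ P h hσ0 hσ1.le hσ2 s hw a z n δ).symm
      _ ≤ ∫⁻ p, (c * G.indicator 1 p + c⁻¹ * (gd s a z n δ p * gd s a z n δ p))
            ∂(P.prod volume) := by
          refine lintegral_mono fun p => pz_aux _ _ c hc0 hct ?_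
          by_cases hp : p ∈ G
          · left; rw [Set.indicator_of_mem hp]; rfl
          · right
            unfold gd
            refine Finset.sum_eq_zero fun w _ => ?_
            rw [ind_of_lt, mul_zero]
            by_contra hh
            exact hp (Set.mem_iUnion.2 ⟨w, not_lt.1 hh⟩)
      _ = c * (P.prod volume) G + c⁻¹ * ∫⁻ p, gd s a z n δ p * gd s a z n δ p
            ∂(P.prod volume) := by
          rw [lintegral_add_left ((measurable_one.indicator hGm).const_mul _),
            lintegral_const_mul _ (measurable_one.indicator hGm), lintegral_indicator_one hGm]
          congr 1
          exact lintegral_const_mul _ (mg.mul mg)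
      _ ≤ c * (P.prod volume) G + c⁻¹ * (U * ENNReal.ofReal (A * δ ^ d)) := by
          gcongr
          exact (int_gd2 P hσ0 hσ1.le hσ2 s a z n δ).trans (mul_le_mul' le_rfl hS)
      _ = _ := by
          congr 1
          have e : c = 2 * ENNReal.ofReal (A * δ ^ d) := by
            rw [hc, ENNReal.ofReal_mul (by norm_num)]; simp
          have e1 : ENNReal.ofReal (A * δ ^ d) ≠ 0 := by
            rw [Ne, ENNReal.ofReal_eq_zero, not_le]; positivity
          rw [e, ENNReal.mul_inv (by simp) (by simp), ENNReal.div_eq_inv_mul]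
          calc _ = 2⁻¹ * U * ((ENNReal.ofReal (A * δ ^ d))⁻¹ * ENNReal.ofReal (A * δ ^ d)) := by
                ring
            _ = _ := by rw [ENNReal.inv_mul_cancel e1 ENNReal.ofReal_ne_top, mul_one]
  have hUt : U ≠ ⊤ := by rw [hUV]; exact ENNReal.mul_ne_top ENNReal.ofReal_ne_top hVt
  have key2 : U / 2 ≤ c * (P.prod volume) G := by
    have h2 : U / 2 + U / 2 ≤ c * (P.prod volume) G + U / 2 := by rwa [ENNReal.add_halves]
    exact (ENNReal.add_le_add_iff_right (ENNReal.div_lt_top hUt (by simp)).ne).1 h2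
  refine ENNReal.div_le_of_le_mul ?_
  have e2 : ENNReal.ofReal (δ ^ d) * (V / 2) ≤
      ENNReal.ofReal (δ ^ d) * ((P.prod volume) G * ENNReal.ofReal (2 * A)) := by
    calc _ = U / 2 := by rw [hUV, mul_div_assoc]
      _ ≤ _ := key2
      _ = _ := by
        rw [hc, ← mul_assoc 2 A, ENNReal.ofReal_mul (by positivity)]; ring
  exact (ENNReal.mul_le_mul_iff_right (by
    rw [Ne, ENNReal.ofReal_eq_zero, not_le]; positivity) ENNReal.ofReal_ne_top).1 e2

lemma good_set (h : IsProductLaw θ P) (hd : 1 ≤ d) (hm : 2 ≤ m) (s : ℝ) (hs : (d : ℝ) < s)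
    (hσ0 : 0 < σm) (hσ1 : σm < σp) (hσ2 : σp < 1) [IsProbabilityMeasure θ] [θ.IsMulLeftInvariant]
    (hw : (m : ℝ≥0∞) * ∫⁻ l, wl s l ∂(labelM σm σp θ) = 1)
    (a : Fin m → E d) (ha : Function.Injective a) :
    ∃ A : Set (Omega d m σm σp), MeasurableSet A ∧ P A ≠ 0 ∧
      ∀ ω ∈ A, 0 < (volume : Measure (E d)) (Fset a ω) := by
  let z : Fin m := ⟨0, by omega⟩
  obtain ⟨η, hη, H⟩ := vol_lower θ P h hd hm s hs hσ0 hσ1 hσ2 hw a ha z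
  have hpos : ∀ k : ℕ, (0 : ℝ) < 1 / ((k : ℝ) + 1) := fun k => by positivity
  choose n hn using fun k : ℕ => H (1 / ((k : ℝ) + 1)) (hpos k)
  let f : ℕ → Omega d m σm σp → ℝ≥0∞ := fun k ω =>
    volume (Prod.mk ω ⁻¹' (Gs a z (n k) (1 / ((k : ℝ) + 1))))
  have hsub : ∀ (k : ℕ) (ω : Omega d m σm σp), Prod.mk ω ⁻¹' (Gs a z (n k) (1 / ((k : ℝ) + 1))) ⊆
      Metric.cthickening (1 / ((k : ℝ) + 1)) (Fset a ω) := by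
    intro k ω x hx
    obtain ⟨w, hw⟩ := Set.mem_iUnion.1 hx
    have hw' : ‖pt a z (n k) w ω - x‖ ≤ 1 / ((k : ℝ) + 1) := hw
    refine Metric.mem_cthickening_of_dist_le _ _ _ _ (pt_mem hσ0 hσ1.le hσ2 a z (n k) w ω) ?_
    rw [dist_comm, dist_eq_norm]; exact hw'
  have hfm : ∀ k, Measurable (f k) := fun k =>
    measurable_measure_prodMk_left (measurableSet_Gs hσ0 hσ1.le hσ2 a z (n k) _)
  have hfint : ∀ k, η ≤ ∫⁻ ω, f k ω ∂P := by
    intro k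
    have := hn k
    rwa [Measure.prod_apply (measurableSet_Gs hσ0 hσ1.le hσ2 a z (n k) _)] at this
  let M : ℝ≥0∞ := volume (Metric.closedBall (0 : E d) (RB σp a + 1))
  have hM : M ≠ ⊤ := measure_closedBall_lt_top.ne
  have hfM : ∀ k ω, f k ω ≤ M := by
    intro k ω
    refine measure_mono fun x hx => ?_
    obtain ⟨w, hw⟩ := Set.mem_iUnion.1 hx
    have hw' : ‖pt a z (n k) w ω - x‖ ≤ 1 / ((k : ℝ) + 1) := hw
    obtain ⟨i, hi⟩ := pt_mem hσ0 hσ1.le hσ2 a z (n k) w ω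
    have h1 := norm_piMap_le hσ0 hσ1.le hσ2 a ω i
    rw [hi] at h1
    have h2 : 1 / ((k : ℝ) + 1) ≤ 1 := by
      rw [div_le_one (by positivity)]; linarith [Nat.cast_nonneg (α := ℝ) k]
    rw [mem_closedBall_zero_iff]
    have e : x = pt a z (n k) w ω - (pt a z (n k) w ω - x) := by abel
    rw [e]
    exact (norm_sub_le _ _).trans (by linarith)
  have hlim := limsup_lintegral_le (μ := P) (f := f) (fun _ => M) hfm
    (fun k => Eventually.of_forall (hfM k)) (by simpa using hM)
  have hηl : η ≤ ∫⁻ ω, limsup (fun k => f k ω) atTop ∂P := by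
    refine le_trans ?_ hlim
    exact le_limsup_of_frequently_le (Eventually.of_forall hfint).frequently
  have hLm : Measurable (fun ω => limsup (fun k => f k ω) atTop) := Measurable.limsup hfm
  refine ⟨{ω | 0 < limsup (fun k => f k ω) atTop}, measurableSet_lt measurable_const hLm, ?_, ?_⟩
  · intro h0
    have : ∫⁻ ω, limsup (fun k => f k ω) atTop ∂P = 0 := by
      rw [lintegral_eq_zero_iff hLm]
      have h1 : ∀ᵐ ω ∂P, ω ∉ {ω | 0 < limsup (fun k => f k ω) atTop} :=
        measure_eq_zero_iff_ae_notMem.1 h0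
      filter_upwards [h1] with ω hω
      exact le_antisymm (not_lt.1 hω) (zero_le)
    rw [this] at hηl
    exact hη (le_antisymm hηl (zero_le))
  · intro ω hω
    refine lt_of_lt_of_le (show 0 < limsup (fun k => f k ω) atTop from hω) ?_
    have ht : Tendsto (fun k : ℕ => volume (Metric.cthickening (1 / ((k : ℝ) + 1)) (Fset a ω)))
        atTop (𝓝 (volume (Fset a ω))) :=
      (tendsto_measure_cthickening_of_isCompact (isCompact_Fset hσ0 hσ1.le hσ2 a ω)).comp
        tendsto_one_div_add_atTop_nhds_zero_nat
    rw [← ht.limsup_eq]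
    exact limsup_le_limsup (Eventually.of_forall fun k => measure_mono (hsub k ω))

/-- iterated subtree -/
def subL (ω : Omega d m σm σp) : List (Fin m) → Omega d m σm σp
  | [] => ω
  | i :: u => subL (sub ω i) u

lemma measurable_subL (u : List (Fin m)) : Measurable (fun ω : Omega d m σm σp => subL ω u) := by
  induction u with
  | nil => exact measurable_id
  | cons i u ih => exact ih.comp (measurable_sub i)

lemma subL_pos (hσ0 : 0 < σm) (hσ1 : σm ≤ σp) (hσ2 : σp < 1) (a : Fin m → E d)
    (u : List (Fin m)) (ω : Omega d m σm σp)
    (h : 0 < (volume : Measure (E d)) (Fset a (subL ω u))) :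
    0 < (volume : Measure (E d)) (Fset a ω) := by
  induction u generalizing ω with
  | nil => exact h
  | cons i u ih => exact vol_sub_pos hσ0 hσ1 hσ2 a ω i (ih _ h)

lemma zero_one (h : IsProductLaw θ P) (hm : 2 ≤ m) (A : Set (Omega d m σm σp))
    (hA : MeasurableSet A) (hPA : P A ≠ 0) : ∀ᵐ ω ∂P, ∃ u, subL ω u ∈ A := by
  let N : Set (Omega d m σm σp) := ⋂ u : List (Fin m), {ω | subL ω u ∉ A}
  have hN : MeasurableSet N := MeasurableSet.iInter fun u => (measurable_subL u) hA.compl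
  let i : Fin m := ⟨0, by omega⟩
  let j : Fin m := ⟨1, by omega⟩
  have hij : i ≠ j := by simp [i, j]
  have h1 : P N ≤ P N * P N := by
    have mi : Measurable (N.indicator (1 : Omega d m σm σp → ℝ≥0∞)) := measurable_one.indicator hN
    have mΦ : Measurable (fun p : (Label d σm σp × Omega d m σm σp) ×
        (Label d σm σp × Omega d m σm σp) =>
        N.indicator (1 : Omega d m σm σp → ℝ≥0∞) p.1.2 * N.indicator (1 : Omega d m σm σp → ℝ≥0∞) p.2.2) :=
      (mi.comp (measurable_snd.comp measurable_fst)).mul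
        (mi.comp (measurable_snd.comp measurable_snd))
    have := E2 θ P h i j hij _ mΦ
    simp only [lintegral_const, measure_univ, mul_one] at this
    have e : ∀ ω : Omega d m σm σp, ∫⁻ ω' : Omega d m σm σp, N.indicator (1 : Omega d m σm σp → ℝ≥0∞) ω *
        N.indicator (1 : Omega d m σm σp → ℝ≥0∞) ω' ∂P = N.indicator (1 : Omega d m σm σp → ℝ≥0∞) ω * P N := by
      intro ω
      rw [lintegral_const_mul _ mi, lintegral_indicator_one hN]
    simp only [e] at this
    rw [lintegral_mul_const _ mi, lintegral_indicator_one hN] at this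
    rw [← this]
    nth_rewrite 1 [← lintegral_indicator_one hN]
    refine lintegral_mono fun ω => ?_
    by_cases hω : ω ∈ N
    · have hs : ∀ k : Fin m, sub ω k ∈ N := by
        intro k
        refine Set.mem_iInter.2 fun u => ?_
        exact Set.mem_iInter.1 hω (k :: u)
      simp only [Set.indicator_of_mem hω, Set.indicator_of_mem (hs i),
        Set.indicator_of_mem (hs j)]
      simp
    · rw [Set.indicator_of_notMem hω]; exact zero_le
  have h2 : P N < 1 := by
    have hsub : N ⊆ Aᶜ := fun ω hω => Set.mem_iInter.1 hω []
    refine (measure_mono hsub).trans_lt ?_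
    rw [prob_compl_eq_one_sub hA]
    exact ENNReal.sub_lt_self (by simp) (by simp) hPA
  have h3 : P N = 0 := by
    by_contra h0
    have h4 : P N * P N < P N * 1 :=
      (ENNReal.mul_lt_mul_iff_right h0 (measure_ne_top _ _)).2 h2
    rw [mul_one] at h4
    exact absurd h1 (not_le.2 h4)
  filter_upwards [measure_eq_zero_iff_ae_notMem.1 h3] with ω hω
  by_contra hh
  push Not at hh
  exact hω (Set.mem_iInter.2 hh)

end main

end SecE


/-- Theorem 2.2 (main theorem, positive measure part): if `s > d` then for `ℙ`-almost
every `ω` the set `F(ω)` has positive `d`-dimensional Lebesgue measure. -/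
theorem stmt18 (d m : ℕ) (hd : 1 ≤ d) (hm : 2 ≤ m)
    (σm σp : ℝ) (hσ0 : 0 < σm) (hσ1 : σm ≤ σp) (hσ2 : σp < 1)
    (a : Fin m → E d) (ha : Function.Injective a)
    (θ : Measure (Od d)) (hθ1 : IsProbabilityMeasure θ) (hθ2 : θ.IsMulLeftInvariant)
    (P : Measure (Omega d m σm σp)) (hP1 : IsProbabilityMeasure P)
    (hP2 : IsProductLaw θ P)
    (s : ℝ) (hs0 : 0 < s)
    (hs : ((m : ℝ) / (σp - σm)) * (∫ r in σm..σp, r ^ s) = 1)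
    (hsd : (d : ℝ) < s) :
    ∀ᵐ ω ∂P, 0 < (volume : Measure (E d)) (Fset a ω) := by
  have hlt := lt_of_hs m s hσ1 hs
  have := labelM_prob hlt θ
  have hw := lintegral_wl s hσ0 hlt hs θ
  obtain ⟨A, hA, hPA, hF⟩ := good_set θ P hP2 hd hm s hsd hσ0 hlt hσ2 hw a ha
  filter_upwards [zero_one θ P hP2 hm A hA hPA] with ω hω
  obtain ⟨u, hu⟩ := hω
  exact subL_pos hσ0 hσ1 hσ2 a u ω (hF _ hu)
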